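/- arXiv:2505.04924 — 11 statements merged into one kernel-verified Lean document; each statement's English description precedes it below -/
import Mathlib

section
/- For every 1 ≤ k ≤ n ≤ N the complementary discrete convolution kernel satisfies 0 < P^{(n)}_{n−k} ≤ Γ(2−σ) τ_k^σ. -/
open Finset in
/-- If `P` solves the recursion complementary to the lower triangular kernel `A` (where `A j k`
is the entry in row `j` and column `k`), then `∑_{j=k}^n P j * A j k = 1` for every column `k`. -/
lemma complementary_sum_eq_one {n : ℕ} {A : ℕ → ℕ → ℝ} {P : ℕ → ℝ}
    (hdiag : ∀ k, 1 ≤ k → k ≤ n → A k k ≠ 0)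
    (hlast : P n = 1 / A n n)
    (hrec : ∀ k, 1 ≤ k → k < n →
      P k = (1 / A k k) * ∑ j ∈ Icc (k + 1) n, (A j (k + 1) - A j k) * P j)
    {k : ℕ} (hk : 1 ≤ k) (hkn : k ≤ n) :
    ∑ j ∈ Icc k n, P j * A j k = 1 := by
  induction hkn using Nat.decreasingInduction with
  | self =>
    have := hdiag n hk le_rfl
    simp [hlast, this]
  | of_succ k hkn ih =>
    have hA := hdiag k hk hkn.le
    have hsplit : ∑ j ∈ Icc k n, P j * A j k =
        P k * A k k + ∑ j ∈ Icc (k + 1) n, P j * A j k := by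
      rw [← Finset.insert_Icc_add_one_left_eq_Icc hkn.le, sum_insert (by simp)]
    have hPk : P k * A k k = ∑ j ∈ Icc (k + 1) n, (A j (k + 1) - A j k) * P j := by
      rw [hrec k hk hkn]
      field_simp
    rw [hsplit, hPk, ← sum_add_distrib, ← ih (by omega)]
    exact sum_congr rfl fun j _ => by ring

open Finset in
/-- The solution of the complementary recursion is positive when the kernel has a positive
diagonal and strictly increasing rows. -/
lemma complementary_pos {n : ℕ} {A : ℕ → ℕ → ℝ} {P : ℕ → ℝ}
    (hdiag : ∀ k, 1 ≤ k → k ≤ n → 0 < A k k)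
    (hmono : ∀ j k, 1 ≤ k → k < j → j ≤ n → A j k < A j (k + 1))
    (hlast : P n = 1 / A n n)
    (hrec : ∀ k, 1 ≤ k → k < n →
      P k = (1 / A k k) * ∑ j ∈ Icc (k + 1) n, (A j (k + 1) - A j k) * P j)
    {k : ℕ} (hk : 1 ≤ k) (hkn : k ≤ n) : 0 < P k := by
  induction hm : n - k using Nat.strong_induction_on generalizing k with
  | _ m ih =>
    rcases hkn.eq_or_lt with rfl | hlt
    · rw [hlast]
      exact one_div_pos.2 (hdiag _ hk le_rfl)
    · rw [hrec k hk hlt]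
      refine mul_pos (one_div_pos.2 (hdiag k hk hkn)) (sum_pos (fun j hj => ?_) ⟨n, by simp; omega⟩)
      rw [mem_Icc] at hj
      exact mul_pos (sub_pos.2 (hmono j k hk (by omega) hj.2))
        (ih (n - j) (by omega) (by omega) hj.2 rfl)

/-- The difference quotients of `x ↦ (c - x) ^ p`, `0 < p < 1`, strictly increase in modulus
from one interval to the next. -/
lemma rpow_sub_slope_lt {p c x y z : ℝ} (hp0 : 0 < p) (hp1 : p < 1)
    (hxy : x < y) (hyz : y < z) (hzc : z ≤ c) :
    ((c - x) ^ p - (c - y) ^ p) / (y - x) < ((c - y) ^ p - (c - z) ^ p) / (z - y) := by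
  have h := (Real.strictConcaveOn_rpow hp0 hp1).slope_anti_adjacent
    (x := c - z) (y := c - y) (z := c - x)
    (Set.mem_Ici.2 (by linarith)) (Set.mem_Ici.2 (by linarith)) (by linarith) (by linarith)
  simpa only [sub_sub_sub_cancel_left] using h


/-- For every `1 ≤ k ≤ n ≤ N` the complementary discrete convolution
kernel satisfies `0 < P^{(n)}_{n−k} ≤ Γ(2−σ) τ_k^σ`. -/
theorem complementary_kernel_positive_and_bounded
    (σ T : ℝ) (hσ0 : 0 < σ) (hσ1 : σ < 1) (hT : 0 < T)
    (N : ℕ) (hN : 1 ≤ N)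
    (t : ℕ → ℝ) (ht0 : t 0 = 0)
    (htmono : ∀ k < N, t k < t (k + 1)) (htT : t N ≤ T)
    (a : ℕ → ℕ → ℝ)
    (ha : ∀ n k : ℕ, 1 ≤ k → k ≤ n → n ≤ N →
      a n (n - k) =
        ((t n - t (k - 1)) ^ (1 - σ) / Real.Gamma (2 - σ)
          - (t n - t k) ^ (1 - σ) / Real.Gamma (2 - σ)) / (t k - t (k - 1)))
    (P : ℕ → ℕ → ℝ)
    (hP0 : ∀ n : ℕ, 1 ≤ n → n ≤ N → P n 0 = 1 / a n 0)
    (hPrec : ∀ n k : ℕ, 1 ≤ k → k ≤ n - 1 → n ≤ N →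
      P n (n - k) = (1 / a k 0) *
        ∑ j ∈ Finset.Icc (k + 1) n, (a j (j - k - 1) - a j (j - k)) * P n (n - j)) :
    ∀ n k : ℕ, 1 ≤ k → k ≤ n → n ≤ N →
      0 < P n (n - k) ∧ P n (n - k) ≤ Real.Gamma (2 - σ) * (t k - t (k - 1)) ^ σ := by
  intro n k hk hkn hnN
  have hstep : ∀ i, 1 ≤ i → i ≤ N → t (i - 1) < t i := fun i hi hiN => by
    simpa [Nat.sub_add_cancel hi] using htmono (i - 1) (by omega)
  have hle : ∀ i j, i ≤ j → j ≤ N → t i ≤ t j := by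
    intro i j hij
    induction j, hij using Nat.le_induction with
    | base => exact fun _ => le_rfl
    | succ j _ ih => exact fun hj => (ih (by omega)).trans (htmono j (by omega)).le
  have hΓ : 0 < Real.Gamma (2 - σ) := Real.Gamma_pos_of_pos (by linarith)
  have hdiag : ∀ i, 1 ≤ i → i ≤ N →
      a i (i - i) = 1 / (Real.Gamma (2 - σ) * (t i - t (i - 1)) ^ σ) := by
    intro i hi hiN
    have hτ : 0 < t i - t (i - 1) := sub_pos.2 (hstep i hi hiN)
    rw [ha i i hi le_rfl hiN, sub_self, Real.zero_rpow (by linarith), Real.rpow_sub hτ,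
      Real.rpow_one]
    have := Real.rpow_pos_of_pos hτ σ
    field_simp
    simp
  have hdiag_pos : ∀ i, 1 ≤ i → i ≤ n → 0 < a i (i - i) := fun i hi hin => by
    have hτ : 0 < t i - t (i - 1) := sub_pos.2 (hstep i hi (hin.trans hnN))
    rw [hdiag i hi (hin.trans hnN)]
    positivity
  have hmono : ∀ j i, 1 ≤ i → i < j → j ≤ n → a j (j - i) < a j (j - (i + 1)) := by
    intro j i hi hij hjn
    rw [ha j i hi hij.le (hjn.trans hnN), ha j (i + 1) (by omega) hij (hjn.trans hnN),
      Nat.add_sub_cancel, ← sub_div, ← sub_div, div_right_comm, div_right_comm _ _ (_ - _)]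
    exact div_lt_div_of_pos_right (rpow_sub_slope_lt (by linarith) (by linarith)
      (hstep i hi (by omega)) (htmono i (by omega)) (hle _ _ hij (by omega))) hΓ
  have hlast : P n (n - n) = 1 / a n (n - n) := by
    simpa using hP0 n (by omega) hnN
  have hrec : ∀ i, 1 ≤ i → i < n → P n (n - i) = (1 / a i (i - i)) *
      ∑ j ∈ Finset.Icc (i + 1) n, (a j (j - (i + 1)) - a j (j - i)) * P n (n - j) := by
    intro i hi hin
    simpa [Nat.sub_sub] using hPrec n i hi (by omega) hnN
  have hpos : ∀ i, 1 ≤ i → i ≤ n → 0 < P n (n - i) := fun i hi hin =>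
    complementary_pos (A := fun j i => a j (j - i)) (P := fun j => P n (n - j))
      hdiag_pos hmono hlast hrec hi hin
  have hsum : ∑ j ∈ Finset.Icc k n, P n (n - j) * a j (j - k) = 1 :=
    complementary_sum_eq_one (A := fun j i => a j (j - i)) (P := fun j => P n (n - j))
      (fun i hi hin => (hdiag_pos i hi hin).ne') hlast hrec hk hkn
  have hrow : ∀ j, k ≤ j → j ≤ n → 0 ≤ a j (j - k) := by
    intro j hkj hjn
    have hτ := sub_pos.2 (hstep k hk (by omega))
    have h0 := hle k j hkj (by omega)
    rw [ha j k hk hkj (by omega), ← sub_div]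
    refine div_nonneg (div_nonneg (sub_nonneg.2 ?_) hΓ.le) hτ.le
    exact Real.rpow_le_rpow (by linarith) (by linarith) (by linarith)
  refine ⟨hpos k hk hkn, ?_⟩
  have hterm : P n (n - k) * a k (k - k) ≤ 1 := by
    rw [← hsum]
    refine Finset.single_le_sum (f := fun j => P n (n - j) * a j (j - k)) (fun j hj => ?_)
      (Finset.left_mem_Icc.2 hkn)
    rw [Finset.mem_Icc] at hj
    exact mul_nonneg (hpos j (by omega) hj.2).le (hrow j hj.1 hj.2)
  have hτ := Real.rpow_pos_of_pos (sub_pos.2 (hstep k hk (hkn.trans hnN))) σ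
  rwa [hdiag k hk (hkn.trans hnN), mul_one_div, div_le_one (by positivity)] at hterm
end

section
/- For every 1 ≤ k ≤ n ≤ N one has the identity Σ_{j=k}^{n} P^{(n)}_{n−j} a^{(j)}_{j−k} = 1. -/
/-- A kernel `P` defined recursively from the coefficients `a` at level `n` is complementary
to `a`, provided the leading coefficients `a k 0` do not vanish. -/
theorem sum_complementary_kernel_mul_eq_one {K : Type*} [Field K] {n : ℕ} {a : ℕ → ℕ → K}
    {p : ℕ → K} (ha : ∀ k, 1 ≤ k → k ≤ n → a k 0 ≠ 0) (hp0 : p 0 = 1 / a n 0)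
    (hp : ∀ k, 1 ≤ k → k < n → p (n - k) = (1 / a k 0) *
      ∑ j ∈ Finset.Icc (k + 1) n, (a j (j - k - 1) - a j (j - k)) * p (n - j))
    {k : ℕ} (hk : 1 ≤ k) (hkn : k ≤ n) :
    ∑ j ∈ Finset.Icc k n, p (n - j) * a j (j - k) = 1 := by
  induction hkn using Nat.decreasingInduction with
  | self => simp [hp0, ha n hk le_rfl]
  | of_succ k hkn ih =>
    rw [← ih (by omega), ← Finset.add_sum_Ioc_eq_sum_Icc hkn.le, Nat.sub_self, hp k hk hkn,
      one_div, mul_right_comm, inv_mul_cancel₀ (ha k hk hkn.le), one_mul,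
      ← Finset.Icc_add_one_left_eq_Ioc, ← Finset.sum_add_distrib]
    refine Finset.sum_congr rfl fun j _ => ?_
    rw [Nat.sub_sub]
    ring

/-- For every `1 ≤ k ≤ n ≤ N` one has the identity
`Σ_{j=k}^{n} P^{(n)}_{n−j} a^{(j)}_{j−k} = 1`. -/
theorem complementary_kernel_identity
    (σ T : ℝ) (hσ0 : 0 < σ) (hσ1 : σ < 1) (hT : 0 < T)
    (N : ℕ) (hN : 1 ≤ N)
    (t : ℕ → ℝ) (ht0 : t 0 = 0)
    (htmono : ∀ k < N, t k < t (k + 1)) (htT : t N ≤ T)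
    (a : ℕ → ℕ → ℝ)
    (ha : ∀ n k : ℕ, 1 ≤ k → k ≤ n → n ≤ N →
      a n (n - k) =
        ((t n - t (k - 1)) ^ (1 - σ) / Real.Gamma (2 - σ)
          - (t n - t k) ^ (1 - σ) / Real.Gamma (2 - σ)) / (t k - t (k - 1)))
    (P : ℕ → ℕ → ℝ)
    (hP0 : ∀ n : ℕ, 1 ≤ n → n ≤ N → P n 0 = 1 / a n 0)
    (hPrec : ∀ n k : ℕ, 1 ≤ k → k ≤ n - 1 → n ≤ N →
      P n (n - k) = (1 / a k 0) *
        ∑ j ∈ Finset.Icc (k + 1) n, (a j (j - k - 1) - a j (j - k)) * P n (n - j)) :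
    ∀ n k : ℕ, 1 ≤ k → k ≤ n → n ≤ N →
      ∑ j ∈ Finset.Icc k n, P n (n - j) * a j (j - k) = 1 := by
  intro n k hk hkn hnN
  refine sum_complementary_kernel_mul_eq_one (p := P n) (fun m hm hmn => ?_)
    (hP0 n (hk.trans hkn) hnN) (fun m hm hmn => hPrec n m hm (by omega) hnN) hk hkn
  have hstep : 0 < t m - t (m - 1) := by
    have h := htmono (m - 1) (by omega)
    rw [Nat.sub_add_cancel hm] at h
    exact sub_pos.mpr h
  have hΓ : 0 < Real.Gamma (2 - σ) := Real.Gamma_pos_of_pos (by linarith)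
  have h := ha m m hm le_rfl (hmn.trans hnN)
  rw [Nat.sub_self, sub_self, Real.zero_rpow (by linarith), zero_div, sub_zero] at h
  rw [h]
  exact (div_pos (div_pos (Real.rpow_pos_of_pos hstep _) hΓ) hstep).ne'
end

section
/- For every 1 ≤ n ≤ N one has Σ_{k=1}^{n} P^{(n)}_{n−k} k̃_{1−σ}(t_k) ≤ 1, i.e. Σ_{k=1}^{n} P^{(n)}_{n−k} t_k^{−σ} ≤ Γ(1−σ). -/
/-- The tangent line of `x ↦ x ^ p` at `x` bounds the power from above. -/
theorem mul_rpow_sub_one_le_slope_rpow {p x y : ℝ} (hp0 : 0 < p) (hp1 : p ≤ 1)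
    (hy : 0 ≤ y) (hyx : y < x) :
    p * x ^ (p - 1) ≤ (x ^ p - y ^ p) / (x - y) := by
  have hx : 0 < x := hy.trans_lt hyx
  have h := (Real.concaveOn_rpow hp0.le hp1).le_slope_of_hasDerivAt
    (Set.mem_Ici.2 hy) (Set.mem_Ici.2 hx.le) hyx (Real.hasDerivAt_rpow_const (Or.inl hx.ne'))
  rwa [slope_def_field] at h

/-- The complementary identity: the recursion for the kernel `p` makes it a discrete left inverse
of the lower triangular array `b j k`. -/
theorem sum_mul_eq_one_of_complementary_rec {n : ℕ} {b : ℕ → ℕ → ℝ} {p : ℕ → ℝ}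
    (hb : ∀ k, 1 ≤ k → k ≤ n → b k k ≠ 0) (hn : p n = 1 / b n n)
    (hp : ∀ k, 1 ≤ k → k < n →
      p k = (1 / b k k) * ∑ j ∈ Finset.Icc (k + 1) n, (b j (k + 1) - b j k) * p j)
    {k : ℕ} (hk : 1 ≤ k) (hkn : k ≤ n) :
    ∑ j ∈ Finset.Icc k n, p j * b j k = 1 := by
  induction hkn using Nat.decreasingInduction with
  | self => simp [hn, hb n hk le_rfl]
  | of_succ k hkn ih =>
    have h := hp k hk hkn
    rw [one_div, eq_inv_mul_iff_mul_eq₀ (hb k hk hkn.le)] at h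
    rw [← Finset.add_sum_Ioc_eq_sum_Icc hkn.le, mul_comm, h, ← ih (by omega),
      ← Finset.Icc_succ_left_eq_Ioc, Order.succ_eq_add_one, ← Finset.sum_add_distrib]
    exact Finset.sum_congr rfl fun j _ => by ring

/-- The complementary kernel of an array that is positive on the diagonal and nondecreasing along
rows is nonnegative. -/
theorem nonneg_of_complementary_rec {n : ℕ} {b : ℕ → ℕ → ℝ} {p : ℕ → ℝ}
    (hb : ∀ k, 1 ≤ k → k ≤ n → 0 < b k k)
    (hmono : ∀ j k, 1 ≤ k → k < j → j ≤ n → b j k ≤ b j (k + 1)) (hn : p n = 1 / b n n)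
    (hp : ∀ k, 1 ≤ k → k < n →
      p k = (1 / b k k) * ∑ j ∈ Finset.Icc (k + 1) n, (b j (k + 1) - b j k) * p j)
    {k : ℕ} (hk : 1 ≤ k) (hkn : k ≤ n) : 0 ≤ p k := by
  induction h : n - k using Nat.strong_induction_on generalizing k with
  | _ m ih =>
    have hbk := hb k hk hkn
    rcases hkn.eq_or_lt with rfl | hlt
    · rw [hn]; positivity
    · rw [hp k hk hlt]
      refine mul_nonneg (by positivity) (Finset.sum_nonneg fun j hj => ?_)
      rw [Finset.mem_Icc] at hj
      exact mul_nonneg (sub_nonneg.2 (hmono j k hk (by omega) hj.2))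
        (ih (n - j) (by omega) (by omega) hj.2 rfl)

/-- For every `1 ≤ n ≤ N` one has
`Σ_{k=1}^{n} P^{(n)}_{n−k} k̃_{1−σ}(t_k) ≤ 1`, i.e.
`Σ_{k=1}^{n} P^{(n)}_{n−k} t_k^{−σ} ≤ Γ(1−σ)`. -/
theorem complementary_kernel_weighted_sum_bound
    (σ T : ℝ) (hσ0 : 0 < σ) (hσ1 : σ < 1) (hT : 0 < T)
    (N : ℕ) (hN : 1 ≤ N)
    (t : ℕ → ℝ) (ht0 : t 0 = 0)
    (htmono : ∀ k < N, t k < t (k + 1)) (htT : t N ≤ T)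
    (a : ℕ → ℕ → ℝ)
    (ha : ∀ n k : ℕ, 1 ≤ k → k ≤ n → n ≤ N →
      a n (n - k) =
        ((t n - t (k - 1)) ^ (1 - σ) / Real.Gamma (2 - σ)
          - (t n - t k) ^ (1 - σ) / Real.Gamma (2 - σ)) / (t k - t (k - 1)))
    (P : ℕ → ℕ → ℝ)
    (hP0 : ∀ n : ℕ, 1 ≤ n → n ≤ N → P n 0 = 1 / a n 0)
    (hPrec : ∀ n k : ℕ, 1 ≤ k → k ≤ n - 1 → n ≤ N →
      P n (n - k) = (1 / a k 0) *
        ∑ j ∈ Finset.Icc (k + 1) n, (a j (j - k - 1) - a j (j - k)) * P n (n - j)) :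
    ∀ n : ℕ, 1 ≤ n → n ≤ N →
      (∑ k ∈ Finset.Icc 1 n, P n (n - k) * ((t k) ^ (-σ) / Real.Gamma (1 - σ)) ≤ 1) ∧
      (∑ k ∈ Finset.Icc 1 n, P n (n - k) * (t k) ^ (-σ) ≤ Real.Gamma (1 - σ)) := by
  have hΓ1 : 0 < Real.Gamma (1 - σ) := Real.Gamma_pos_of_pos (by linarith)
  have hΓ2 : Real.Gamma (2 - σ) = (1 - σ) * Real.Gamma (1 - σ) := by
    rw [← Real.Gamma_add_one (by linarith)]; congr 1; ring
  have hΓ2pos : 0 < Real.Gamma (2 - σ) := Real.Gamma_pos_of_pos (by linarith)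
  have hlt : ∀ i j, i < j → j ≤ N → t i < t j := by
    intro i j hij hj
    induction j, hij using Nat.le_induction with
    | base => exact htmono i hj
    | succ j _ ih => exact (ih (by omega)).trans (htmono j hj)
  have hle : ∀ i j, i ≤ j → j ≤ N → t i ≤ t j := fun i j hij hj =>
    hij.eq_or_lt.elim (fun h => h ▸ le_rfl) fun h => (hlt i j h hj).le
  have ha' : ∀ n k : ℕ, 1 ≤ k → k ≤ n → n ≤ N → a n (n - k) =
      ((t n - t (k - 1)) ^ (1 - σ) - (t n - t k) ^ (1 - σ)) /
        ((t n - t (k - 1)) - (t n - t k)) / Real.Gamma (2 - σ) := by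
    intro n k hk hkn hn
    rw [ha n k hk hkn hn, ← sub_div, div_right_comm]
    congr 2; ring
  have hpos : ∀ k, 1 ≤ k → k ≤ N → 0 < a k (k - k) := by
    intro k hk hkN
    have h := hlt (k - 1) k (by omega) hkN
    rw [ha' k k hk le_rfl hkN, sub_self, sub_zero, Real.zero_rpow (by linarith), sub_zero]
    have := sub_pos.2 h
    positivity
  have hmono : ∀ j k, 1 ≤ k → k < j → j ≤ N → a j (j - k) ≤ a j (j - (k + 1)) := by
    intro j k hk hkj hj
    rw [ha' j k hk hkj.le hj, ha' j (k + 1) (by omega) hkj hj, Nat.add_sub_cancel]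
    have h1 := hlt (k - 1) k (by omega) (by omega)
    have h2 := hlt k (k + 1) (by omega) (by omega)
    have h3 := hle (k + 1) j hkj hj
    refine div_le_div_of_nonneg_right ?_ hΓ2pos.le
    exact (Real.concaveOn_rpow (p := 1 - σ) (by linarith) (by linarith)).slope_anti_adjacent
      (Set.mem_Ici.2 (by linarith)) (Set.mem_Ici.2 (by linarith)) (by linarith) (by linarith)
  have hbound : ∀ j, 1 ≤ j → j ≤ N → t j ^ (-σ) / Real.Gamma (1 - σ) ≤ a j (j - 1) := by
    intro j hj hjN
    have h1 := hlt 0 1 one_pos (by omega)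
    have h2 := hle 1 j hj hjN
    rw [ha' j 1 le_rfl hj hjN, Nat.sub_self, hΓ2, ht0, sub_zero]
    have hs := mul_rpow_sub_one_le_slope_rpow (p := 1 - σ) (x := t j) (y := t j - t 1)
      (by linarith) (by linarith) (by linarith) (by linarith)
    rw [show 1 - σ - 1 = -σ by ring] at hs
    rw [← mul_div_mul_left _ _ (show 1 - σ ≠ 0 by linarith)]
    have h3 : 0 < 1 - σ := by linarith
    gcongr
  intro n hn hnN
  have hPn : P n (n - n) = 1 / a n (n - n) := by rw [Nat.sub_self]; exact hP0 n hn hnN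
  have hPk : ∀ k, 1 ≤ k → k < n → P n (n - k) = (1 / a k (k - k)) *
      ∑ j ∈ Finset.Icc (k + 1) n, (a j (j - (k + 1)) - a j (j - k)) * P n (n - j) := by
    intro k hk hkn
    rw [Nat.sub_self]
    exact hPrec n k hk (by omega) hnN
  have hsum := sum_mul_eq_one_of_complementary_rec (b := fun j k => a j (j - k))
    (p := fun k => P n (n - k)) (fun k hk hkn => (hpos k hk (hkn.trans hnN)).ne') hPn hPk
    le_rfl hn
  have key : ∑ k ∈ Finset.Icc 1 n, P n (n - k) * ((t k) ^ (-σ) / Real.Gamma (1 - σ)) ≤ 1 := by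
    refine le_of_le_of_eq ?_ hsum
    refine Finset.sum_le_sum fun k hk => ?_
    rw [Finset.mem_Icc] at hk
    refine mul_le_mul_of_nonneg_left (hbound k hk.1 (hk.2.trans hnN)) ?_
    exact nonneg_of_complementary_rec (b := fun j k => a j (j - k))
      (p := fun k => P n (n - k)) (fun k hk hkn => hpos k hk (hkn.trans hnN))
      (fun j k hk hkj hj => hmono j k hk hkj (hj.trans hnN)) hPn hPk hk.1 hk.2
  refine ⟨key, ?_⟩
  simp only [← mul_div_assoc] at key
  rwa [← Finset.sum_div, div_le_one hΓ1] at key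
end

section
/- For every 1 ≤ n ≤ N one has Σ_{k=1}^{n} P^{(n)}_{n−k} ≤ t_n^σ / Γ(1+σ), i.e. the sum of the complementary discrete convolution kernel weights is bounded by k̃_{1+σ}(t_n). -/
open intervalIntegral in
/-- **Chebyshev's integral inequality**, with the mean of the monotone factor attained at a point. -/
theorem integral_mul_le_of_antitoneOn_of_monotoneOn {f g : ℝ → ℝ} {x y c : ℝ} (hc : c ∈ Set.Ioo x y)
    (hf : AntitoneOn f (Set.Ioo x y)) (hg : MonotoneOn g (Set.Ioo x y))
    (hfi : IntervalIntegrable f MeasureTheory.volume x y)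
    (hgi : IntervalIntegrable g MeasureTheory.volume x y)
    (hfgi : IntervalIntegrable (fun s => f s * g s) MeasureTheory.volume x y)
    (hgc : ∫ s in x..y, g s = g c * (y - x)) :
    ∫ s in x..y, f s * g s ≤ g c * ∫ s in x..y, f s := by
  have hxy : x ≤ y := (hc.1.trans hc.2).le
  have hi : IntervalIntegrable (fun s => g c * f s + f c * g s) MeasureTheory.volume x y :=
    (hfi.const_mul _).add (hgi.const_mul _)
  have hle : ∫ s in x..y, f s * g s ≤ ∫ s in x..y, (g c * f s + f c * g s - f c * g c) := by
    refine integral_mono_on_of_le_Ioo hxy hfgi (hi.sub intervalIntegrable_const) fun s hs => ?_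
    rcases le_total s c with h | h
    · nlinarith [mul_nonneg (sub_nonneg.2 (hf hs hc h)) (sub_nonneg.2 (hg hs hc h))]
    · nlinarith [mul_nonneg (sub_nonneg.2 (hf hc hs h)) (sub_nonneg.2 (hg hc hs h))]
  rw [integral_sub hi intervalIntegrable_const,
    integral_add (hfi.const_mul _) (hgi.const_mul _), integral_const_mul, integral_const_mul,
    integral_const, hgc, smul_eq_mul] at hle
  linarith

theorem integral_rpow_mul_sub_rpow_neg {σ x : ℝ} (hσ0 : 0 < σ) (hσ1 : σ < 1) (hx : 0 < x) :
    ∫ s in 0..x, s ^ (σ - 1) * (x - s) ^ (-σ) = Real.Gamma σ * Real.Gamma (1 - σ) := by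
  have h := Complex.betaIntegral_scaled (σ : ℂ) ((1 - σ : ℝ) : ℂ) hx
  have hb := Complex.Gamma_mul_Gamma_eq_betaIntegral (s := (σ : ℂ)) (t := ((1 - σ : ℝ) : ℂ))
    (by simpa using hσ0) (by simpa using hσ1)
  have hsum : (σ : ℂ) + ((1 - σ : ℝ) : ℂ) = 1 := by push_cast; ring
  rw [hsum, Complex.Gamma_one, one_mul] at hb
  rw [hsum, sub_self, Complex.cpow_zero, one_mul, ← hb, Complex.Gamma_ofReal,
    Complex.Gamma_ofReal] at h
  apply Complex.ofReal_injective
  rw [← intervalIntegral.integral_ofReal, Complex.ofReal_mul, ← h]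
  refine intervalIntegral.integral_congr fun s hs => ?_
  rw [Set.uIcc_of_le hx.le] at hs
  simp only [Complex.ofReal_mul]
  rw [Complex.ofReal_cpow hs.1, Complex.ofReal_cpow (sub_nonneg.2 hs.2)]
  push_cast
  ring_nf

theorem intervalIntegrable_rpow_mul_sub_rpow_neg {σ x : ℝ} (hσ0 : 0 < σ) (hσ1 : σ < 1)
    (hx : 0 < x) :
    IntervalIntegrable (fun s => s ^ (σ - 1) * (x - s) ^ (-σ)) MeasureTheory.volume 0 x := by
  by_contra h
  have h0 := intervalIntegral.integral_undef h
  rw [integral_rpow_mul_sub_rpow_neg hσ0 hσ1 hx] at h0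
  exact (mul_pos (Real.Gamma_pos_of_pos hσ0) (Real.Gamma_pos_of_pos (sub_pos.2 hσ1))).ne' h0

theorem exists_sub_rpow_neg_eq_slope {σ x y z : ℝ} (hσ1 : σ < 1) (hxy : x < y) (hyz : y ≤ z) :
    ∃ c ∈ Set.Ioo x y,
      (z - c) ^ (-σ) = ((z - x) ^ (1 - σ) - (z - y) ^ (1 - σ)) / (1 - σ) / (y - x) := by
  have hσ : 1 - σ ≠ 0 := (sub_pos.2 hσ1).ne'
  obtain ⟨c, hc, h⟩ := exists_hasDerivAt_eq_slope (fun s => -((z - s) ^ (1 - σ) / (1 - σ)))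
    (fun s => (z - s) ^ (-σ)) hxy
    (((continuous_const.sub continuous_id).continuousOn.rpow_const
      fun _ _ => Or.inr (sub_pos.2 hσ1).le).div_const _).neg
    (fun s hs => by
      have hs' : z - s ≠ 0 := (sub_pos.2 (hs.2.trans_le hyz)).ne'
      have := ((((hasDerivAt_id s).const_sub z).rpow_const (p := 1 - σ)
        (Or.inl hs')).div_const (1 - σ)).neg
      refine this.congr_deriv ?_
      rw [show 1 - σ - 1 = -σ by ring, id]
      field_simp)
  refine ⟨c, hc, h.trans ?_⟩
  congr 1
  ring

theorem integral_rpow_mul_sub_rpow_neg_le {σ x y z c : ℝ} (hσ0 : 0 < σ) (hσ1 : σ < 1)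
    (hx : 0 ≤ x) (hyz : y ≤ z) (hc : c ∈ Set.Ioo x y)
    (h : (z - c) ^ (-σ) = ((z - x) ^ (1 - σ) - (z - y) ^ (1 - σ)) / (1 - σ) / (y - x))
    (hi : IntervalIntegrable (fun s => s ^ (σ - 1) * (z - s) ^ (-σ)) MeasureTheory.volume x y) :
    ∫ s in x..y, s ^ (σ - 1) * (z - s) ^ (-σ) ≤ (z - c) ^ (-σ) * ((y ^ σ - x ^ σ) / σ) := by
  have hxy : x < y := hc.1.trans hc.2
  have hintegral : ∫ s in x..y, s ^ (σ - 1) = (y ^ σ - x ^ σ) / σ := by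
    rw [integral_rpow (Or.inl (by linarith)), sub_add_cancel]
  rw [← hintegral]
  refine integral_mul_le_of_antitoneOn_of_monotoneOn (g := fun s => (z - s) ^ (-σ)) hc
    (fun s hs r _ hsr => ?_) (fun s _ r hr hsr => ?_)
    (intervalIntegral.intervalIntegrable_rpow' (by linarith)) ?_ hi ?_
  · exact Real.rpow_le_rpow_of_nonpos (hx.trans_lt hs.1) hsr (by linarith)
  · exact Real.rpow_le_rpow_of_nonpos (sub_pos.2 (hr.2.trans_le hyz)) (by linarith) (by linarith)
  · have := (intervalIntegral.intervalIntegrable_rpow' (a := z - x) (b := z - y)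
      (r := -σ) (by linarith)).comp_sub_left z
    simpa using this
  · rw [intervalIntegral.integral_comp_sub_left (fun s => s ^ (-σ)),
      integral_rpow (Or.inl (by linarith)), h, div_mul_cancel₀ _ (sub_pos.2 hxy).ne',
      neg_add_eq_sub]

/-- A discrete kernel `A` that is positive on the diagonal and increasing in its second index has a
nonnegative complementary kernel `p`, and `p` is summed by `A` to one. -/
theorem complementary_kernel_nonneg_and_sum_eq_one {n : ℕ} {A : ℕ → ℕ → ℝ} {p : ℕ → ℝ}
    (hpos : ∀ k, 1 ≤ k → k ≤ n → 0 < A k k)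
    (hmono : ∀ j k, 1 ≤ k → k < j → j ≤ n → A j k ≤ A j (k + 1))
    (hn : p n = 1 / A n n)
    (hrec : ∀ k, 1 ≤ k → k < n →
      p k = (1 / A k k) * ∑ j ∈ Finset.Icc (k + 1) n, (A j (k + 1) - A j k) * p j)
    {k : ℕ} (hk : 1 ≤ k) (hkn : k ≤ n) :
    0 ≤ p k ∧ ∑ j ∈ Finset.Icc k n, p j * A j k = 1 := by
  have hstrong : ∀ m, k ≤ m → m ≤ n →
      (∀ j, m ≤ j → j ≤ n → 0 ≤ p j) ∧ ∑ j ∈ Finset.Icc m n, p j * A j m = 1 := by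
    intro m hkm hmn
    induction hmn using Nat.decreasingInduction with
    | self =>
      have h := hpos n (hk.trans hkn) le_rfl
      refine ⟨fun j hj hjn => ?_, ?_⟩
      · rw [le_antisymm hjn hj, hn]
        positivity
      · rw [Finset.Icc_self, Finset.sum_singleton, hn, one_div, inv_mul_cancel₀ h.ne']
    | of_succ m hmn ih =>
      obtain ⟨hnonneg, hsum⟩ := ih (by omega)
      have h := hpos m (hk.trans hkm) hmn.le
      have hm := hrec m (hk.trans hkm) hmn
      refine ⟨fun j hj hjn => ?_, ?_⟩
      · rcases hj.eq_or_lt with rfl | hj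
        · rw [hm]
          refine mul_nonneg (by positivity) (Finset.sum_nonneg fun i hi => ?_)
          rw [Finset.mem_Icc] at hi
          exact mul_nonneg (sub_nonneg.2 (hmono i m (hk.trans hkm) hi.1 hi.2))
            (hnonneg i hi.1 hi.2)
        · exact hnonneg j hj hjn
      · have hpm : p m * A m m = ∑ j ∈ Finset.Icc (m + 1) n, (A j (m + 1) - A j m) * p j := by
          rw [hm]
          field_simp
        rw [← Finset.add_sum_Ioc_eq_sum_Icc hmn.le, hpm, ← Finset.Icc_add_one_left_eq_Ioc,
          ← Finset.sum_add_distrib, ← hsum]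
        exact Finset.sum_congr rfl fun j _ => by ring
  exact ⟨(hstrong k le_rfl hkn).1 k le_rfl hkn, (hstrong k le_rfl hkn).2⟩

/-- If `v` is a grid function whose discrete derivative is at least one, the complementary kernel
has total mass at most `v n - v 0`. -/
theorem sum_complementary_kernel_le {n : ℕ} {A : ℕ → ℕ → ℝ} {p v : ℕ → ℝ}
    (hp : ∀ k, 1 ≤ k → k ≤ n → 0 ≤ p k)
    (hsum : ∀ k, 1 ≤ k → k ≤ n → ∑ j ∈ Finset.Icc k n, p j * A j k = 1)
    (hv : ∀ j, 1 ≤ j → j ≤ n → 1 ≤ ∑ k ∈ Finset.Icc 1 j, A j k * (v k - v (k - 1))) :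
    ∑ k ∈ Finset.Icc 1 n, p k ≤ v n - v 0 := by
  calc ∑ j ∈ Finset.Icc 1 n, p j
      ≤ ∑ j ∈ Finset.Icc 1 n, ∑ k ∈ Finset.Icc 1 j, p j * A j k * (v k - v (k - 1)) := by
        refine Finset.sum_le_sum fun j hj => ?_
        rw [Finset.mem_Icc] at hj
        simp_rw [mul_assoc]
        rw [← Finset.mul_sum]
        exact le_mul_of_one_le_right (hp j hj.1 hj.2) (hv j hj.1 hj.2)
    _ = ∑ k ∈ Finset.Icc 1 n, ∑ j ∈ Finset.Icc k n, p j * A j k * (v k - v (k - 1)) :=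
        Finset.sum_comm' fun j k => by simp only [Finset.mem_Icc]; omega
    _ = ∑ k ∈ Finset.Icc 1 n, (v k - v (k - 1)) := by
        refine Finset.sum_congr rfl fun k hk => ?_
        rw [Finset.mem_Icc] at hk
        rw [← Finset.sum_mul, hsum k hk.1 hk.2, one_mul]
    _ = v n - v 0 := by
        rw [← Finset.sum_range_sub, Finset.range_eq_Ico, ← Finset.Ico_add_one_right_eq_Icc,
          Finset.sum_Ico_add' (fun k => v k - v (k - 1)) 0 n 1 |>.symm]
        simp

/-- The L1 discretization of the Caputo derivative of order `σ` of `s ^ σ / Γ(1 + σ)`, written with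
the intermediate points `c j k`, is at least one. -/
theorem one_le_sum_kernel_mul_rpow_sub {σ : ℝ} (hσ0 : 0 < σ) (hσ1 : σ < 1) {n : ℕ} (hn : 1 ≤ n)
    {t c : ℕ → ℝ} (ht0 : t 0 = 0) (ht : ∀ k < n, t k < t (k + 1))
    (hc : ∀ k, k < n → c (k + 1) ∈ Set.Ioo (t k) (t (k + 1)))
    (hslope : ∀ k, k < n → (t n - c (k + 1)) ^ (-σ) =
      ((t n - t k) ^ (1 - σ) - (t n - t (k + 1)) ^ (1 - σ)) / (1 - σ) / (t (k + 1) - t k)) :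
    1 ≤ ∑ k ∈ Finset.Icc 1 n, (t n - c k) ^ (-σ) / Real.Gamma (1 - σ) *
      (t k ^ σ / Real.Gamma (1 + σ) - t (k - 1) ^ σ / Real.Gamma (1 + σ)) := by
  have hmono : MonotoneOn t (Set.Iic n) := by
    intro i _ j hj hij
    induction j, hij using Nat.le_induction with
    | base => exact le_rfl
    | succ j hij ih => exact (ih (Nat.le_of_succ_le hj)).trans (ht j hj).le
  have hle : ∀ {i j}, i ≤ j → j ≤ n → t i ≤ t j := fun hij hj => hmono (hij.trans hj) hj hij
  have hnonneg : ∀ k ≤ n, 0 ≤ t k := fun k hk => ht0 ▸ hle k.zero_le hk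
  have hpos : 0 < t n := ht0 ▸ (ht 0 hn).trans_le (hle hn le_rfl)
  have hi : ∀ k < n, IntervalIntegrable (fun s => s ^ (σ - 1) * (t n - s) ^ (-σ))
      MeasureTheory.volume (t k) (t (k + 1)) := fun k hk =>
    (intervalIntegrable_rpow_mul_sub_rpow_neg hσ0 hσ1 hpos).mono_set (by
      rw [Set.uIcc_of_le (ht k hk).le, Set.uIcc_of_le hpos.le]
      exact Set.Icc_subset_Icc (hnonneg k hk.le) (hle hk le_rfl))
  have hintegral := intervalIntegral.sum_integral_adjacent_intervals hi
  rw [ht0, integral_rpow_mul_sub_rpow_neg hσ0 hσ1 hpos] at hintegral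
  have hΓ := Real.Gamma_pos_of_pos hσ0
  have hΓ' := Real.Gamma_pos_of_pos (sub_pos.2 hσ1)
  rw [← Finset.Ico_add_one_right_eq_Icc,
    ← Finset.sum_Ico_add' (fun k => (t n - c k) ^ (-σ) / Real.Gamma (1 - σ) *
      (t k ^ σ / Real.Gamma (1 + σ) - t (k - 1) ^ σ / Real.Gamma (1 + σ))) 0 n 1,
    ← Finset.range_eq_Ico]
  refine ((div_self (mul_pos hΓ hΓ').ne').symm.trans
    ((congrArg (· / _) hintegral.symm).trans (Finset.sum_div _ _ _))).trans_le ?_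
  refine Finset.sum_le_sum fun k hk => ?_
  rw [Finset.mem_range] at hk
  have h := integral_rpow_mul_sub_rpow_neg_le hσ0 hσ1 (hnonneg k hk.le) (hle hk le_rfl) (hc k hk)
    (hslope k hk) (hi k hk)
  rw [div_le_iff₀ (mul_pos hΓ hΓ'), add_comm 1 σ, Real.Gamma_add_one hσ0.ne', add_tsub_cancel_right]
  refine h.trans_eq ?_
  field_simp

/-- For every `1 ≤ n ≤ N` one has
`Σ_{k=1}^{n} P^{(n)}_{n−k} ≤ t_n^σ / Γ(1+σ)`, i.e. the sum of the complementary
discrete convolution kernel weights is bounded by `k̃_{1+σ}(t_n)`. -/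
theorem complementary_kernel_sum_bound
    (σ T : ℝ) (hσ0 : 0 < σ) (hσ1 : σ < 1) (hT : 0 < T)
    (N : ℕ) (hN : 1 ≤ N)
    (t : ℕ → ℝ) (ht0 : t 0 = 0)
    (htmono : ∀ k < N, t k < t (k + 1)) (htT : t N ≤ T)
    (a : ℕ → ℕ → ℝ)
    (ha : ∀ n k : ℕ, 1 ≤ k → k ≤ n → n ≤ N →
      a n (n - k) =
        ((t n - t (k - 1)) ^ (1 - σ) / Real.Gamma (2 - σ)
          - (t n - t k) ^ (1 - σ) / Real.Gamma (2 - σ)) / (t k - t (k - 1)))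
    (P : ℕ → ℕ → ℝ)
    (hP0 : ∀ n : ℕ, 1 ≤ n → n ≤ N → P n 0 = 1 / a n 0)
    (hPrec : ∀ n k : ℕ, 1 ≤ k → k ≤ n - 1 → n ≤ N →
      P n (n - k) = (1 / a k 0) *
        ∑ j ∈ Finset.Icc (k + 1) n, (a j (j - k - 1) - a j (j - k)) * P n (n - j)) :
    ∀ n : ℕ, 1 ≤ n → n ≤ N →
      ∑ k ∈ Finset.Icc 1 n, P n (n - k) ≤ (t n) ^ σ / Real.Gamma (1 + σ) := by
  intro n hn hnN
  have hle : ∀ i j, i ≤ j → j ≤ N → t i ≤ t j := by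
    intro i j hij hj
    induction j, hij using Nat.le_induction with
    | base => exact le_rfl
    | succ j hij ih => exact (ih (Nat.le_of_succ_le hj)).trans (htmono j hj).le
  have hexists : ∀ j k : ℕ, ∃ c, k < j → j ≤ N → c ∈ Set.Ioo (t k) (t (k + 1)) ∧
      (t j - c) ^ (-σ) =
        ((t j - t k) ^ (1 - σ) - (t j - t (k + 1)) ^ (1 - σ)) / (1 - σ) / (t (k + 1) - t k) := by
    intro j k
    by_cases h : k < j ∧ j ≤ N
    · obtain ⟨c, hc, hs⟩ := exists_sub_rpow_neg_eq_slope hσ1 (htmono k (h.1.trans_le h.2))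
        (hle (k + 1) j h.1 h.2)
      exact ⟨c, fun _ _ => ⟨hc, hs⟩⟩
    · exact ⟨0, fun h1 h2 => absurd ⟨h1, h2⟩ h⟩
  choose c hc using hexists
  have hΓ := Real.Gamma_pos_of_pos (sub_pos.2 hσ1)
  have hA : ∀ j k, k < j → j ≤ N →
      a j (j - (k + 1)) = (t j - c j k) ^ (-σ) / Real.Gamma (1 - σ) := by
    intro j k hkj hj
    have hΓ2 : Real.Gamma (2 - σ) = (1 - σ) * Real.Gamma (1 - σ) := by
      rw [← Real.Gamma_add_one (sub_pos.2 hσ1).ne']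
      congr 1
      ring
    rw [ha j (k + 1) (by omega) hkj hj, (hc j k hkj hj).2, hΓ2, add_tsub_cancel_right,
      ← sub_div, div_right_comm, div_div, div_div, div_div]
    congr 1
    ring
  have hlt : ∀ j k, k < j → j ≤ N → c j k < t j := fun j k hkj hj =>
    (hc j k hkj hj).1.2.trans_le (hle _ _ hkj hj)
  have hkernel : ∀ k, 1 ≤ k → k ≤ n → 0 ≤ P n (n - k) ∧
      ∑ j ∈ Finset.Icc k n, P n (n - j) * a j (j - k) = 1 := by
    intro k hk hkn
    refine complementary_kernel_nonneg_and_sum_eq_one (A := fun j k => a j (j - k))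
      (p := fun j => P n (n - j)) ?_ ?_ ?_ ?_ hk hkn
    · intro m hm hmn
      obtain ⟨m, rfl⟩ := Nat.exists_eq_add_of_le' hm
      rw [hA (m + 1) m (by omega) (by omega)]
      exact div_pos (Real.rpow_pos_of_pos
        (sub_pos.2 (hlt (m + 1) m (by omega) (by omega))) _) hΓ
    · intro j m hm hmj hj
      obtain ⟨m, rfl⟩ := Nat.exists_eq_add_of_le' hm
      rw [hA j m (by omega) (by omega), hA j (m + 1) hmj (by omega)]
      refine div_le_div_of_nonneg_right (Real.rpow_le_rpow_of_nonpos
        (sub_pos.2 (hlt j (m + 1) hmj (by omega))) ?_ (by linarith)) hΓ.le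
      have h1 := (hc j m (by omega) (by omega)).1.2
      have h2 := (hc j (m + 1) hmj (by omega)).1.1
      linarith
    · simpa using hP0 n hn hnN
    · intro m hm hmn
      simpa [Nat.sub_sub] using hPrec n m hm (by omega) hnN
  have hfinal := sum_complementary_kernel_le (A := fun j k => a j (j - k))
    (p := fun j => P n (n - j)) (v := fun k => t k ^ σ / Real.Gamma (1 + σ))
    (fun k hk hkn => (hkernel k hk hkn).1) (fun k hk hkn => (hkernel k hk hkn).2)
    (fun j hj hjn => by
      refine (one_le_sum_kernel_mul_rpow_sub hσ0 hσ1 hj (c := fun k => c j (k - 1)) ht0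
        (fun k hk => htmono k (by omega))
        (fun k hk => (hc j k hk (by omega)).1)
        (fun k hk => (hc j k hk (by omega)).2)).trans_eq ?_
      refine Finset.sum_congr rfl fun k hk => ?_
      rw [Finset.mem_Icc] at hk
      obtain ⟨k, rfl⟩ := Nat.exists_eq_add_of_le' hk.1
      rw [hA j k hk.2 (by omega), add_tsub_cancel_right])
  simpa [ht0, Real.zero_rpow hσ0.ne'] using hfinal
end

section
/- Let H be a real inner product space, let n ≥ 1, let a_0 ≥ a_1 ≥ ⋯ ≥ a_{n−1} > 0 be a nonincreasing sequence of positive reals, and let v_0, v_1, …, v_n ∈ H. Then 2 ⟨ Σ_{k=1}^{n} a_{n−k} (v_k − v_{k−1}), v_n ⟩ ≥ Σ_{k=1}^{n} a_{n−k} (‖v_k‖² − ‖v_{k−1}‖²). -/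
open scoped RealInnerProductSpace

/-- A sum of backward differences of a nonnegative sequence `w`, weighted by a nonnegative
nondecreasing sequence `b`, is bounded below by its boundary term. -/
theorem neg_mul_le_sum_Icc_mul_sub {b w : ℕ → ℝ} {n : ℕ} (hn : 1 ≤ n) (hb : 0 ≤ b 1)
    (hmono : ∀ k, 1 ≤ k → k < n → b k ≤ b (k + 1)) (hw : ∀ k, 0 ≤ w k) :
    -(b n * w n) ≤ ∑ k ∈ Finset.Icc 1 n, b k * (w (k - 1) - w k) := by
  induction n, hn using Nat.le_induction with
  | base =>
    have := mul_nonneg hb (hw 0)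
    simp only [Finset.Icc_self, Finset.sum_singleton, Nat.sub_self]
    linarith
  | succ m hm ih =>
    have hsum := ih fun k hk hkm => hmono k hk (hkm.trans m.lt_succ_self)
    have hstep := mul_le_mul_of_nonneg_right (hmono m hm m.lt_succ_self) (hw m)
    rw [Finset.sum_Icc_succ_top (Nat.le_add_left 1 m), Nat.add_sub_cancel]
    linarith

/-- The difference of squared distances to a point, expanded. -/
theorem norm_sub_sq_sub_norm_sub_sq {H : Type*} [NormedAddCommGroup H] [InnerProductSpace ℝ H]
    (x y z : H) :
    ‖z - x‖ ^ 2 - ‖z - y‖ ^ 2 = 2 * ⟪y - x, z⟫ - (‖y‖ ^ 2 - ‖x‖ ^ 2) := by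
  rw [norm_sub_sq_real, norm_sub_sq_real, inner_sub_left, real_inner_comm z x,
    real_inner_comm z y]
  ring

/-- Let `H` be a real inner product space, `n ≥ 1`,
`a_0 ≥ a_1 ≥ ⋯ ≥ a_{n−1} > 0` a nonincreasing sequence of positive reals, and
`v_0, …, v_n ∈ H`. Then
`2 ⟨ Σ_{k=1}^{n} a_{n−k} (v_k − v_{k−1}), v_n ⟩ ≥ Σ_{k=1}^{n} a_{n−k} (‖v_k‖² − ‖v_{k−1}‖²)`. -/
theorem discrete_quadratic_inequality
    {H : Type*} [NormedAddCommGroup H] [InnerProductSpace ℝ H]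
    (n : ℕ) (hn : 1 ≤ n) (a : ℕ → ℝ)
    (hpos : ∀ j : ℕ, j ≤ n - 1 → 0 < a j)
    (hmono : ∀ j : ℕ, j + 1 ≤ n - 1 → a (j + 1) ≤ a j)
    (v : ℕ → H) :
    2 * ⟪∑ k ∈ Finset.Icc 1 n, a (n - k) • (v k - v (k - 1)), v n⟫ ≥
      ∑ k ∈ Finset.Icc 1 n, a (n - k) * (‖v k‖ ^ 2 - ‖v (k - 1)‖ ^ 2) := by
  have key := neg_mul_le_sum_Icc_mul_sub (b := fun k => a (n - k))
    (w := fun k => ‖v n - v k‖ ^ 2) hn (hpos _ le_rfl).le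
    (fun k hk hkn => by
      have h := hmono (n - (k + 1)) (by omega)
      rwa [show n - (k + 1) + 1 = n - k by omega] at h)
    (fun k => sq_nonneg _)
  simp only [norm_sub_sq_sub_norm_sub_sq, sub_self, norm_zero, ne_eq, OfNat.ofNat_ne_zero,
    not_false_eq_true, zero_pow, mul_zero, neg_zero] at key
  rw [ge_iff_le, ← sub_nonneg, sum_inner, Finset.mul_sum, ← Finset.sum_sub_distrib]
  simpa only [real_inner_smul_left, mul_left_comm (2 : ℝ), ← mul_sub] using key
end

section
/- Let q̃ = min(2−σ, γσ). There exists a constant Q > 0 depending only on T, σ and γ (but not on N) such that: for every C ≥ 0 and every sequence of nonnegative reals r_1, …, r_N satisfying r_n ≤ C n^{−q̃} for all 1 ≤ n ≤ N, one has Σ_{n=1}^{m} P^{(m)}_{m−n} r_n ≤ Q C N^{−q̃} for all 1 ≤ m ≤ N. -/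
/-- The complementary discrete kernel is nonnegative when the coefficients decrease away from
the diagonal. -/
theorem complementary_kernel_nonneg {a : ℕ → ℕ → ℝ} {p : ℕ → ℝ} {m : ℕ}
    (hdiag : ∀ k, 1 ≤ k → k ≤ m → 0 < a k 0)
    (hanti : ∀ j k, 1 ≤ k → k + 1 ≤ j → j ≤ m → a j (j - k) ≤ a j (j - k - 1))
    (hp0 : p 0 = 1 / a m 0)
    (hp : ∀ k, 1 ≤ k → k ≤ m - 1 → p (m - k) = (1 / a k 0) *
      ∑ j ∈ Finset.Icc (k + 1) m, (a j (j - k - 1) - a j (j - k)) * p (m - j))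
    {k : ℕ} (hk : 1 ≤ k) (hkm : k ≤ m) : 0 ≤ p (m - k) := by
  induction hd : m - k using Nat.strong_induction_on generalizing k with
  | _ d ih =>
    have hak := hdiag k hk hkm
    rcases hkm.eq_or_lt with rfl | hlt
    · have hd0 : d = 0 := by omega
      rw [hd0, hp0]
      positivity
    · rw [← hd, hp k hk (by omega)]
      refine mul_nonneg (by positivity) (Finset.sum_nonneg fun j hj => ?_)
      rw [Finset.mem_Icc] at hj
      exact mul_nonneg (sub_nonneg.2 (hanti j k hk hj.1 hj.2))
        (ih (m - j) (by omega) (by omega) hj.2 rfl)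

/-- The complementary discrete kernel is a left inverse of summation of the coefficients. -/
theorem complementary_kernel_sum_eq_one {a : ℕ → ℕ → ℝ} {p : ℕ → ℝ} {m : ℕ}
    (hdiag : ∀ k, 1 ≤ k → k ≤ m → 0 < a k 0)
    (hp0 : p 0 = 1 / a m 0)
    (hp : ∀ k, 1 ≤ k → k ≤ m - 1 → p (m - k) = (1 / a k 0) *
      ∑ j ∈ Finset.Icc (k + 1) m, (a j (j - k - 1) - a j (j - k)) * p (m - j))
    {k : ℕ} (hk : 1 ≤ k) (hkm : k ≤ m) :
    ∑ j ∈ Finset.Icc k m, p (m - j) * a j (j - k) = 1 := by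
  induction hkm using Nat.decreasingInduction with
  | self =>
    have := hdiag m hk le_rfl
    simp only [Finset.Icc_self, Finset.sum_singleton, Nat.sub_self, hp0]
    field_simp
  | of_succ k hlt ih =>
    have hak := hdiag k hk hlt.le
    have key : p (m - k) * a k 0 =
        ∑ j ∈ Finset.Icc (k + 1) m, (a j (j - k - 1) - a j (j - k)) * p (m - j) := by
      rw [hp k hk (by omega)]
      field_simp
    rw [← Finset.insert_Icc_add_one_left_eq_Icc hlt.le, Finset.sum_insert (by simp),
      Nat.sub_self, key, ← Finset.sum_add_distrib, ← ih (by omega)]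
    refine Finset.sum_congr rfl fun j _ => ?_
    rw [Nat.sub_sub]
    ring

/-- Tangent line bound for the concave function `x ↦ x ^ (1 - σ)`. -/
theorem mul_rpow_neg_le_rpow_sub_rpow {σ x y : ℝ} (hσ0 : 0 < σ) (hσ1 : σ < 1) (hx : 0 < x)
    (hyx : y ≤ x) :
    (1 - σ) * x ^ (-σ) * y ≤ x ^ (1 - σ) - (x - y) ^ (1 - σ) := by
  have hyx1 : y / x ≤ 1 := (div_le_one hx).2 hyx
  have hB := rpow_one_add_le_one_add_mul_self (s := -(y / x)) (by linarith)
    (p := 1 - σ) (by linarith) (by linarith)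
  have h1 : x - y = x * (1 + -(y / x)) := by field_simp; ring
  have h2 : x ^ (1 - σ) = x * x ^ (-σ) := by
    rw [sub_eq_add_neg, Real.rpow_add hx, Real.rpow_one]
  have h3 := mul_le_mul_of_nonneg_left hB (Real.rpow_nonneg hx.le (1 - σ))
  rw [h1, Real.mul_rpow hx.le (by linarith)]
  have h4 : x ^ (1 - σ) * (1 + (1 - σ) * -(y / x)) =
      x ^ (1 - σ) - (1 - σ) * x ^ (-σ) * y := by
    rw [h2]; field_simp; ring
  linarith

/-- Let `q̃ = min(2−σ, γσ)`. There exists a constant `Q > 0`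
depending only on `T`, `σ` and `γ` (but not on `N`) such that: for every `C ≥ 0`
and every sequence of nonnegative reals `r_1, …, r_N` satisfying `r_n ≤ C n^{−q̃}`
for all `1 ≤ n ≤ N`, one has `Σ_{n=1}^{m} P^{(m)}_{m−n} r_n ≤ Q C N^{−q̃}` for all
`1 ≤ m ≤ N`.  Here the mesh is the graded mesh `t_n = T (n/N)^γ`. -/
theorem complementary_kernel_consistency_bound
    (σ T γ : ℝ) (hσ0 : 0 < σ) (hσ1 : σ < 1) (hT : 0 < T) (hγ : 1 ≤ γ) :
    ∃ Q > 0, ∀ N : ℕ, 1 ≤ N → ∀ t : ℕ → ℝ,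
      (∀ n : ℕ, n ≤ N → t n = T * ((n : ℝ) / (N : ℝ)) ^ γ) →
      ∀ a : ℕ → ℕ → ℝ,
      (∀ n k : ℕ, 1 ≤ k → k ≤ n → n ≤ N →
        a n (n - k) =
          ((t n - t (k - 1)) ^ (1 - σ) / Real.Gamma (2 - σ)
            - (t n - t k) ^ (1 - σ) / Real.Gamma (2 - σ)) / (t k - t (k - 1))) →
      ∀ P : ℕ → ℕ → ℝ,
      (∀ n : ℕ, 1 ≤ n → n ≤ N → P n 0 = 1 / a n 0) →
      (∀ n k : ℕ, 1 ≤ k → k ≤ n - 1 → n ≤ N →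
        P n (n - k) = (1 / a k 0) *
          ∑ j ∈ Finset.Icc (k + 1) n, (a j (j - k - 1) - a j (j - k)) * P n (n - j)) →
      ∀ C : ℝ, 0 ≤ C → ∀ r : ℕ → ℝ,
      (∀ n : ℕ, 1 ≤ n → n ≤ N →
        0 ≤ r n ∧ r n ≤ C * (n : ℝ) ^ (-min (2 - σ) (γ * σ))) →
      ∀ m : ℕ, 1 ≤ m → m ≤ N →
        ∑ n ∈ Finset.Icc 1 m, P m (m - n) * r n ≤
          Q * C * (N : ℝ) ^ (-min (2 - σ) (γ * σ)) := by
  have hΓ : 0 < Real.Gamma (2 - σ) := Real.Gamma_pos_of_pos (by linarith)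
  have hσ : 0 < 1 - σ := by linarith
  refine ⟨T ^ σ * Real.Gamma (2 - σ) / (1 - σ), by positivity, ?_⟩
  intro N hN t ht a ha P hP0 hP C hC r hr m hm hmN
  have hN0 : (0 : ℝ) < N := by exact_mod_cast hN
  have ht0 : t 0 = 0 := by
    rw [ht 0 (Nat.zero_le _), Nat.cast_zero, zero_div, Real.zero_rpow (by linarith), mul_zero]
  have hmono : ∀ i j, i < j → j ≤ N → t i < t j := by
    intro i j hij hj
    rw [ht i (by omega), ht j hj]
    have hij' : (i : ℝ) < j := by exact_mod_cast hij
    gcongr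
  have hmono' : ∀ i j, i ≤ j → j ≤ N → t i ≤ t j := fun i j hij hj =>
    hij.eq_or_lt.elim (fun h => h ▸ le_rfl) fun h => (hmono i j h hj).le
  have hlow : ∀ n, 1 ≤ n → n ≤ N →
      (1 - σ) / Real.Gamma (2 - σ) * t n ^ (-σ) ≤ a n (n - 1) := by
    intro n hn hnN
    have h1 : 0 < t 1 := ht0 ▸ hmono 0 1 one_pos hN
    have hB := mul_rpow_neg_le_rpow_sub_rpow hσ0 hσ1
      (ht0 ▸ hmono 0 n hn hnN : 0 < t n) (hmono' 1 n hn hnN)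
    rw [ha n 1 le_rfl hn hnN, Nat.sub_self, ht0, sub_zero, sub_zero, ← sub_div, le_div_iff₀ h1,
      le_div_iff₀ hΓ]
    calc (1 - σ) / Real.Gamma (2 - σ) * t n ^ (-σ) * t 1 * Real.Gamma (2 - σ)
        = (1 - σ) * t n ^ (-σ) * t 1 := by field_simp
      _ ≤ _ := hB
  have hdiag : ∀ k, 1 ≤ k → k ≤ m → 0 < a k 0 := by
    intro k hk hkm
    have h1 := hmono (k - 1) k (by omega) (by omega)
    have := ha k k hk le_rfl (by omega)
    rw [Nat.sub_self, sub_self, Real.zero_rpow hσ.ne', zero_div, sub_zero] at this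
    rw [this]
    have := sub_pos.2 h1
    positivity
  have hanti : ∀ j k, 1 ≤ k → k + 1 ≤ j → j ≤ m → a j (j - k) ≤ a j (j - k - 1) := by
    intro j k hk hkj hjm
    rw [Nat.sub_sub, ha j k hk (by omega) (by omega), ha j (k + 1) (by omega) hkj (by omega),
      Nat.add_sub_cancel, ← sub_div, ← sub_div, div_right_comm, div_right_comm _ _ (t (k + 1) - t k)]
    refine div_le_div_of_nonneg_right ?_ hΓ.le
    have h1 := hmono (k - 1) k (by omega) (by omega)
    have h2 := hmono k (k + 1) (by omega) (by omega)
    have h3 := hmono' (k + 1) j hkj (by omega)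
    have := (Real.concaveOn_rpow hσ.le (by linarith : 1 - σ ≤ 1)).slope_anti_adjacent
      (x := t j - t (k + 1)) (y := t j - t k) (z := t j - t (k - 1))
      (Set.mem_Ici.2 (by linarith)) (Set.mem_Ici.2 (by linarith)) (by linarith) (by linarith)
    rwa [sub_sub_sub_cancel_left, sub_sub_sub_cancel_left] at this
  have hpos : ∀ n, 1 ≤ n → n ≤ m → 0 ≤ P m (m - n) := fun n hn hnm =>
    complementary_kernel_nonneg hdiag hanti (hP0 m hm hmN)
      (fun k hk hkm => hP m k hk hkm hmN) hn hnm
  have hsum := complementary_kernel_sum_eq_one hdiag (hP0 m hm hmN)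
    (fun k hk hkm => hP m k hk hkm hmN) le_rfl hm
  set q := min (2 - σ) (γ * σ) with hq
  have hrate : ∀ n, 1 ≤ n → n ≤ N → (n : ℝ) ^ (-q) ≤ N ^ (-q) * (T ^ σ * t n ^ (-σ)) := by
    intro n hn hnN
    have hn0 : (0 : ℝ) < n := by exact_mod_cast hn
    have hnN' : (n : ℝ) ≤ N := by exact_mod_cast hnN
    have hx : (0 : ℝ) < n / N := by positivity
    have hT' : T ^ σ * t n ^ (-σ) = ((n : ℝ) / N) ^ (-(γ * σ)) := by
      rw [ht n hnN, Real.mul_rpow hT.le (by positivity), ← Real.rpow_mul hx.le, ← mul_assoc,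
        ← Real.rpow_add hT, add_neg_cancel, Real.rpow_zero, one_mul, mul_neg]
    calc (n : ℝ) ^ (-q) = N ^ (-q) * ((n : ℝ) / N) ^ (-q) := by
          rw [← Real.mul_rpow hN0.le hx.le, mul_div_cancel₀ _ hN0.ne']
      _ ≤ N ^ (-q) * ((n : ℝ) / N) ^ (-(γ * σ)) := by
          refine mul_le_mul_of_nonneg_left ?_ (by positivity)
          exact Real.rpow_le_rpow_of_exponent_ge hx ((div_le_one hN0).2 hnN')
            (neg_le_neg (min_le_right _ _))
      _ = _ := by rw [hT']
  calc ∑ n ∈ Finset.Icc 1 m, P m (m - n) * r n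
      ≤ ∑ n ∈ Finset.Icc 1 m, T ^ σ * Real.Gamma (2 - σ) / (1 - σ) * C * (N : ℝ) ^ (-q) *
          (P m (m - n) * a n (n - 1)) := by
        refine Finset.sum_le_sum fun n hn => ?_
        obtain ⟨hn1, hnm⟩ := Finset.mem_Icc.1 hn
        have hnN := hnm.trans hmN
        have hr' : r n ≤ T ^ σ * Real.Gamma (2 - σ) / (1 - σ) * C * (N : ℝ) ^ (-q) *
            a n (n - 1) :=
          calc r n ≤ C * (n : ℝ) ^ (-q) := (hr n hn1 hnN).2
            _ ≤ C * (N ^ (-q) * (T ^ σ * t n ^ (-σ))) :=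
                mul_le_mul_of_nonneg_left (hrate n hn1 hnN) hC
            _ = T ^ σ * Real.Gamma (2 - σ) / (1 - σ) * C * (N : ℝ) ^ (-q) *
                ((1 - σ) / Real.Gamma (2 - σ) * t n ^ (-σ)) := by field_simp
            _ ≤ _ := mul_le_mul_of_nonneg_left (hlow n hn1 hnN) (by positivity)
        calc P m (m - n) * r n ≤ P m (m - n) * _ :=
              mul_le_mul_of_nonneg_left hr' (hpos n hn1 hnm)
          _ = _ := by ring
    _ = T ^ σ * Real.Gamma (2 - σ) / (1 - σ) * C * (N : ℝ) ^ (-q) := by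
        rw [← Finset.mul_sum, hsum, mul_one]
end

section
/- For every Q_0 ≥ 0 there exists a constant Q > 0 depending only on T, β, γ and Q_0 (but not on N) such that: if z_0, …, z_N and y_0, …, y_N are nonnegative reals satisfying z_n ≤ y_n + Q_0 Σ_{j=0}^{n−1} μ_{β,n−j} z_j for all 0 ≤ n ≤ N, then z_n ≤ y_n + Q Σ_{j=0}^{n−1} μ_{β,n−j} y_j for all 0 ≤ n ≤ N. -/
open Finset in
/-- Comparison principle for discrete convolution inequalities: a kernel `K` dominating
`c • (μ + μ * K)` bounds the resolvent of `c • μ`. -/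
theorem le_add_sum_of_le_add_conv {N : ℕ} {c : ℝ} (hc : 0 ≤ c) {μ K z y : ℕ → ℝ}
    (hμ : ∀ m, 0 ≤ μ m) (hK0 : K 0 = 0)
    (hK : ∀ m ≤ N, c * (μ m + ∑ i ∈ range m, μ (m - i) * K i) ≤ K m)
    (hy : ∀ n ≤ N, 0 ≤ y n)
    (hz : ∀ n ≤ N, z n ≤ y n + c * ∑ j ∈ range n, μ (n - j) * z j) :
    ∀ n ≤ N, z n ≤ y n + ∑ j ∈ range n, K (n - j) * y j := by
  intro n
  induction n using Nat.strong_induction_on with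
  | _ n ih =>
  intro hn
  have hswap : ∑ j ∈ range n, μ (n - j) * ∑ l ∈ range j, K (j - l) * y l =
      ∑ l ∈ range n, (∑ i ∈ range (n - l), μ (n - l - i) * K i) * y l := by
    simp only [mul_sum, range_eq_Ico]
    rw [← sum_Ico_Ico_comm' 0 n fun l j ↦ μ (n - j) * (K (j - l) * y l)]
    refine sum_congr rfl fun l hl ↦ ?_
    have hl' := (mem_Ico.1 hl).2
    obtain ⟨d, rfl⟩ : ∃ d, n = l + 1 + d := ⟨n - (l + 1), by omega⟩
    rw [sum_Ico_eq_sum_range, ← range_eq_Ico, show l + 1 + d - l = d + 1 by omega,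
      sum_range_succ', hK0, mul_zero, add_zero, sum_mul, Nat.add_sub_cancel_left]
    refine sum_congr rfl fun i _ ↦ ?_
    rw [show l + 1 + d - (l + 1 + i) = d + 1 - (i + 1) by omega,
      show l + 1 + i - l = i + 1 by omega, mul_assoc]
  calc z n ≤ y n + c * ∑ j ∈ range n, μ (n - j) * z j := hz n hn
    _ ≤ y n + c * ∑ j ∈ range n, μ (n - j) * (y j + ∑ l ∈ range j, K (j - l) * y l) := by
      gcongr with j hj
      · exact hμ _
      · have hj' := mem_range.1 hj
        exact ih j hj' (by omega)
    _ = y n + ∑ l ∈ range n,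
          c * (μ (n - l) + ∑ i ∈ range (n - l), μ (n - l - i) * K i) * y l := by
      simp only [mul_add, sum_add_distrib, hswap, add_mul]
      simp only [mul_sum, sum_mul, mul_assoc]
    _ ≤ y n + ∑ j ∈ range n, K (n - j) * y j := by
      gcongr with l hl
      · have hl' := mem_range.1 hl
        exact hy l (by omega)
      · exact hK _ (by omega)

/-- The increments `(m/N)^σ - ((m-1)/N)^σ` of the power function on a uniform mesh of `[0, 1]`,
with value `0` at `m = 0`. -/
noncomputable def rpowIncr (σ : ℝ) (N m : ℕ) : ℝ :=
  ((m : ℝ) / N) ^ σ - (((m - 1 : ℕ) : ℝ) / N) ^ σ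

theorem rpowIncr_zero (σ : ℝ) (N : ℕ) : rpowIncr σ N 0 = 0 := by
  simp [rpowIncr]

theorem rpowIncr_nonneg {σ : ℝ} (hσ : 0 < σ) (N m : ℕ) : 0 ≤ rpowIncr σ N m := by
  unfold rpowIncr
  rw [sub_nonneg]
  gcongr
  omega

theorem rpowIncr_eq {σ : ℝ} {N m : ℕ} (hm : 1 ≤ m) :
    rpowIncr σ N m = (1 - (1 + -(1 / (m : ℝ))) ^ σ) * ((m : ℝ) / N) ^ σ := by
  have hm' : (1 : ℝ) ≤ m := by exact_mod_cast hm
  have h : (0 : ℝ) ≤ 1 + -(1 / (m : ℝ)) := by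
    have : 1 / (m : ℝ) ≤ 1 := (div_le_one (by linarith)).2 hm'
    linarith
  rw [rpowIncr, sub_mul, one_mul, ← Real.mul_rpow h (by positivity), Nat.cast_sub hm]
  congr 2
  field_simp
  push_cast
  ring

theorem rpowIncr_le {σ : ℝ} (hσ : 0 < σ) {N m : ℕ} (hm : 1 ≤ m) :
    rpowIncr σ N m ≤ max 1 σ * (1 / m * ((m : ℝ) / N) ^ σ) := by
  have hm' : (1 : ℝ) ≤ m := by exact_mod_cast hm
  have h0 : 0 < 1 / (m : ℝ) := by positivity
  have h1 : 1 / (m : ℝ) ≤ 1 := (div_le_one (by linarith)).2 hm'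
  rw [rpowIncr_eq hm, ← mul_assoc]
  gcongr
  rcases le_total 1 σ with h | h
  · rw [max_eq_right h]
    have := one_add_mul_self_le_rpow_one_add (s := -(1 / (m : ℝ))) (by linarith) h
    linarith
  · rw [max_eq_left h]
    have := Real.rpow_le_rpow_of_exponent_ge' (x := 1 + -(1 / (m : ℝ))) (by linarith)
      (by linarith) hσ.le h
    rw [Real.rpow_one] at this
    linarith

theorem le_rpowIncr {σ : ℝ} (hσ : 0 < σ) {N m : ℕ} (hm : 1 ≤ m) :
    min 1 σ * (1 / m * ((m : ℝ) / N) ^ σ) ≤ rpowIncr σ N m := by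
  have hm' : (1 : ℝ) ≤ m := by exact_mod_cast hm
  have h0 : 0 < 1 / (m : ℝ) := by positivity
  have h1 : 1 / (m : ℝ) ≤ 1 := (div_le_one (by linarith)).2 hm'
  rw [rpowIncr_eq hm, ← mul_assoc]
  gcongr
  rcases le_total 1 σ with h | h
  · rw [min_eq_left h]
    have := Real.rpow_le_rpow_of_exponent_ge' (x := 1 + -(1 / (m : ℝ))) (by linarith)
      (by linarith) zero_le_one h
    rw [Real.rpow_one] at this
    linarith
  · rw [min_eq_right h]
    have := rpow_one_add_le_one_add_mul_self (s := -(1 / (m : ℝ))) (by linarith) hσ.le h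
    linarith

/-- Increments at comparable indices are comparable, uniformly in the mesh size. -/
theorem rpowIncr_le_mul_rpowIncr {σ : ℝ} (hσ : 0 < σ) {N i m : ℕ} (him : i ≤ m)
    (hmi : m ≤ 2 * i) :
    rpowIncr σ N i ≤ 2 * max 1 σ / min 1 σ * rpowIncr σ N m := by
  rcases Nat.eq_zero_or_pos i with rfl | hi
  · obtain rfl : m = 0 := by omega
    simp [rpowIncr_zero]
  have hm : 1 ≤ m := by omega
  have hi' : (0 : ℝ) < i := by exact_mod_cast hi
  have hm' : (0 : ℝ) < m := by exact_mod_cast hm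
  have hmi' : (m : ℝ) ≤ 2 * i := by exact_mod_cast hmi
  have hmin : 0 < min 1 σ := lt_min one_pos hσ
  calc rpowIncr σ N i ≤ max 1 σ * (1 / i * ((i : ℝ) / N) ^ σ) := rpowIncr_le hσ hi
    _ ≤ max 1 σ * (2 / m * ((m : ℝ) / N) ^ σ) := by
      gcongr ?_ * (?_ * ?_)
      · rw [div_le_div_iff₀ hi' hm']
        linarith
      · gcongr
    _ = 2 * max 1 σ / min 1 σ * (min 1 σ * (1 / m * ((m : ℝ) / N) ^ σ)) := by
      field_simp
    _ ≤ _ := by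
      gcongr
      exact le_rpowIncr hσ hm

open Finset in
/-- Exponentially weighted sum of the increments, split at the point `δ` of `[0, 1]`. -/
theorem sum_exp_mul_rpowIncr_le {σ l δ : ℝ} (hσ : 0 < σ) (hl : 0 ≤ l) (hδ : 0 ≤ δ) {N m : ℕ}
    (hN : 1 ≤ N) (hm : m ≤ N) :
    ∑ i ∈ range (m + 1), Real.exp (-(l * (i / N))) * rpowIncr σ N i ≤
      δ ^ σ + Real.exp (-(l * δ)) := by
  have hN' : (0 : ℝ) < N := by exact_mod_cast hN
  have htel (f : ℕ → ℝ) (k : ℕ) : ∑ i ∈ range (k + 1), (f i - f (i - 1)) = f k - f 0 := by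
    rw [sum_range_succ', Nat.zero_sub, sub_self, add_zero]
    exact sum_range_sub f k
  let g (k : ℕ) : ℝ := min ((k : ℝ) / N) δ ^ σ
  have hg (k : ℕ) : 0 ≤ g k := by positivity
  have hterm (i : ℕ) : Real.exp (-(l * (i / N))) * rpowIncr σ N i ≤
      (g i - g (i - 1)) + Real.exp (-(l * δ)) * rpowIncr σ N i := by
    have hpred : ((i - 1 : ℕ) : ℝ) / N ≤ (i : ℝ) / N := by
      gcongr
      omega
    have hb := rpowIncr_nonneg hσ N i
    rcases le_total ((i : ℝ) / N) δ with h | h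
    · have hgi : g i - g (i - 1) = rpowIncr σ N i := by
        simp only [g, rpowIncr, min_eq_left h, min_eq_left (hpred.trans h)]
      rw [hgi]
      have h1 : Real.exp (-(l * (i / N))) ≤ 1 := Real.exp_le_one_iff.2 (by
        rw [neg_nonpos]; positivity)
      have h2 := mul_le_mul_of_nonneg_right h1 hb
      have h3 := mul_nonneg (Real.exp_pos (-(l * δ))).le hb
      linarith
    · have hgi : g (i - 1) ≤ g i := by
        simp only [g]
        gcongr
      have : Real.exp (-(l * (i / N))) * rpowIncr σ N i ≤
          Real.exp (-(l * δ)) * rpowIncr σ N i := by gcongr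
      linarith
  have hg0 : g m - g 0 ≤ δ ^ σ := by
    have : g m ≤ δ ^ σ := by
      simp only [g]
      gcongr
      exact min_le_right _ _
    linarith [hg 0]
  have hb : ∑ i ∈ range (m + 1), rpowIncr σ N i ≤ 1 := by
    simp only [rpowIncr]
    rw [htel fun k ↦ ((k : ℝ) / N) ^ σ]
    have h1 : ((m : ℝ) / N) ^ σ ≤ 1 := Real.rpow_le_one (by positivity)
      ((div_le_one hN').2 (by exact_mod_cast hm)) hσ.le
    have h0 : (0 : ℝ) ≤ (((0 : ℕ) : ℝ) / N) ^ σ := by positivity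
    linarith
  calc _ ≤ ∑ i ∈ range (m + 1),
        ((g i - g (i - 1)) + Real.exp (-(l * δ)) * rpowIncr σ N i) :=
        sum_le_sum fun i _ ↦ hterm i
    _ = (g m - g 0) + Real.exp (-(l * δ)) * ∑ i ∈ range (m + 1), rpowIncr σ N i := by
      rw [sum_add_distrib, htel g, mul_sum]
    _ ≤ δ ^ σ + Real.exp (-(l * δ)) * 1 := by gcongr
    _ = _ := by rw [mul_one]

theorem exists_sum_exp_mul_rpowIncr_le {σ ε : ℝ} (hσ : 0 < σ) (hε : 0 < ε) :
    ∃ l : ℝ, 0 ≤ l ∧ ∀ N m : ℕ, 1 ≤ N → m ≤ N →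
      ∑ i ∈ Finset.range (m + 1), Real.exp (-(l * (i / N))) * rpowIncr σ N i ≤ ε := by
  have hδ : 0 < (ε / 2) ^ σ⁻¹ := by positivity
  obtain ⟨l, hl, hle⟩ : ∃ l : ℝ, 0 ≤ l ∧ Real.exp (-(l * (ε / 2) ^ σ⁻¹)) ≤ ε / 2 := by
    refine ⟨max 0 (-Real.log (ε / 2) / (ε / 2) ^ σ⁻¹), le_max_left _ _, ?_⟩
    rw [← Real.le_log_iff_exp_le (by positivity), neg_le]
    exact (div_le_iff₀ hδ).1 (le_max_right _ _)
  refine ⟨l, hl, fun N m hN hm ↦ (sum_exp_mul_rpowIncr_le hσ hl hδ.le hN hm).trans ?_⟩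
  rw [Real.rpow_inv_rpow (by positivity) hσ.ne']
  linarith

open Finset in
/-- The exponentially weighted self-convolution of the increments is an arbitrarily small multiple
of the increments, uniformly in the mesh size. -/
theorem exists_conv_rpowIncr_le {σ ε : ℝ} (hσ : 0 < σ) (hε : 0 < ε) :
    ∃ l : ℝ, 0 ≤ l ∧ ∀ N m : ℕ, 1 ≤ N → m ≤ N →
      ∑ i ∈ range m, Real.exp (-(l * ((m - i : ℕ) / N))) * rpowIncr σ N (m - i) *
        rpowIncr σ N i ≤ ε * rpowIncr σ N m := by
  set D := 2 * max 1 σ / min 1 σ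
  have hmin : 0 < min 1 σ := lt_min one_pos hσ
  have hD0 : 0 < D := by positivity
  obtain ⟨l, hl, h⟩ := exists_sum_exp_mul_rpowIncr_le hσ (ε := ε / (2 * D)) (by positivity)
  refine ⟨l, hl, fun N m hN hm ↦ ?_⟩
  let w (i : ℕ) : ℝ := Real.exp (-(l * (i / N))) * rpowIncr σ N i
  have hw (i : ℕ) : 0 ≤ w i := mul_nonneg (Real.exp_pos _).le (rpowIncr_nonneg hσ N i)
  have hbm := rpowIncr_nonneg hσ N m
  have hterm : ∀ i ∈ range (m + 1), w (m - i) * rpowIncr σ N i ≤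
      D * rpowIncr σ N m * (w (m - i) + w i) := by
    intro i hi
    have hi' : i ≤ m := Nat.lt_succ_iff.1 (mem_range.1 hi)
    rcases le_total (m - i) i with hle | hle
    · calc w (m - i) * rpowIncr σ N i ≤ w (m - i) * (D * rpowIncr σ N m) := by
            gcongr
            · exact hw _
            · exact rpowIncr_le_mul_rpowIncr hσ hi' (by omega)
        _ = D * rpowIncr σ N m * (w (m - i) + 0) := by ring
        _ ≤ _ := by
            gcongr
            exact hw _
    · calc w (m - i) * rpowIncr σ N i = Real.exp (-(l * ((m - i : ℕ) / N))) *
              rpowIncr σ N i * rpowIncr σ N (m - i) := by simp only [w]; ring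
        _ ≤ w i * (D * rpowIncr σ N m) := by
            simp only [w]
            have hb := rpowIncr_nonneg hσ N i
            have hb' := rpowIncr_nonneg hσ N (m - i)
            gcongr
            exact rpowIncr_le_mul_rpowIncr hσ (Nat.sub_le _ _) (by omega)
        _ = D * rpowIncr σ N m * (0 + w i) := by ring
        _ ≤ _ := by
            gcongr
            exact hw _
  calc ∑ i ∈ range m, w (m - i) * rpowIncr σ N i
      ≤ ∑ i ∈ range (m + 1), w (m - i) * rpowIncr σ N i := by
        rw [sum_range_succ]
        exact le_add_of_nonneg_right (mul_nonneg (hw _) hbm)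
    _ ≤ ∑ i ∈ range (m + 1), D * rpowIncr σ N m * (w (m - i) + w i) := sum_le_sum hterm
    _ = D * rpowIncr σ N m * (2 * ∑ i ∈ range (m + 1), w i) := by
        rw [← mul_sum, sum_add_distrib, sum_flip w, two_mul]
    _ ≤ D * rpowIncr σ N m * (2 * (ε / (2 * D))) := by
        gcongr
        exact h N m hN hm
    _ = ε * rpowIncr σ N m := by
        field_simp

theorem graded_weight_eq {β T γ : ℝ} (hT : 0 < T) {N : ℕ} {t : ℕ → ℝ}
    (ht : ∀ n : ℕ, n ≤ N → t n = T * ((n : ℝ) / (N : ℝ)) ^ γ) {m : ℕ} (hm : m ≤ N) :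
    ((t m) ^ (1 - β) - (t (m - 1)) ^ (1 - β)) / (1 - β) =
      T ^ (1 - β) / (1 - β) * rpowIncr (γ * (1 - β)) N m := by
  rw [ht m hm, ht (m - 1) (by omega), rpowIncr, Real.mul_rpow hT.le (by positivity),
    Real.mul_rpow hT.le (by positivity), ← Real.rpow_mul (by positivity),
    ← Real.rpow_mul (by positivity)]
  ring

/-- weakly singular discrete Grönwall inequality: For every `Q0 ≥ 0`
there exists `Q > 0` depending only on `T`, `β`, `γ` and `Q0` (but not on `N`)
such that: if `z_0, …, z_N` and `y_0, …, y_N` are nonnegative reals satisfying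
`z_n ≤ y_n + Q0 Σ_{j=0}^{n−1} μ_{β,n−j} z_j` for all `0 ≤ n ≤ N`, then
`z_n ≤ y_n + Q Σ_{j=0}^{n−1} μ_{β,n−j} y_j` for all `0 ≤ n ≤ N`, where
`μ_{β,j} = (t_j^{1−β} − t_{j−1}^{1−β})/(1−β)` on the graded mesh `t_n = T(n/N)^γ`. -/
theorem weakly_singular_discrete_gronwall
    (β T γ Q0 : ℝ) (hβ0 : 0 < β) (hβ1 : β < 1) (hT : 0 < T) (hγ : 1 ≤ γ)
    (hQ0 : 0 ≤ Q0) :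
    ∃ Q > 0, ∀ N : ℕ, 1 ≤ N → ∀ t : ℕ → ℝ,
      (∀ n : ℕ, n ≤ N → t n = T * ((n : ℝ) / (N : ℝ)) ^ γ) →
      ∀ z y : ℕ → ℝ,
      (∀ n : ℕ, n ≤ N → 0 ≤ z n) → (∀ n : ℕ, n ≤ N → 0 ≤ y n) →
      (∀ n : ℕ, n ≤ N → z n ≤ y n + Q0 * ∑ j ∈ Finset.range n,
        ((t (n - j)) ^ (1 - β) - (t (n - j - 1)) ^ (1 - β)) / (1 - β) * z j) →
      ∀ n : ℕ, n ≤ N → z n ≤ y n + Q * ∑ j ∈ Finset.range n,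
        ((t (n - j)) ^ (1 - β) - (t (n - j - 1)) ^ (1 - β)) / (1 - β) * y j := by
  have hα : 0 < 1 - β := by linarith
  have hσ : 0 < γ * (1 - β) := by positivity
  set σ := γ * (1 - β)
  set C := T ^ (1 - β) / (1 - β)
  have hC : 0 < C := by positivity
  obtain ⟨l, hl, hconv⟩ := exists_conv_rpowIncr_le hσ (ε := 1 / (2 * C * (Q0 + 1))) (by positivity)
  set κ := 2 * Q0 + 1
  refine ⟨κ * Real.exp l, by positivity, fun N hN t ht z y _ hy hzy n hn ↦ ?_⟩
  have hN' : (0 : ℝ) < N := by exact_mod_cast hN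
  let μ (m : ℕ) : ℝ := C * rpowIncr σ N m
  have hμ (m : ℕ) : 0 ≤ μ m := mul_nonneg hC.le (rpowIncr_nonneg hσ N m)
  have hsum (x : ℕ → ℝ) {k : ℕ} (hk : k ≤ N) :
      ∑ j ∈ Finset.range k,
        ((t (k - j)) ^ (1 - β) - (t (k - j - 1)) ^ (1 - β)) / (1 - β) * x j =
      ∑ j ∈ Finset.range k, μ (k - j) * x j :=
    Finset.sum_congr rfl fun j _ ↦ by rw [graded_weight_eq hT ht (by omega)]
  let K (m : ℕ) : ℝ := κ * Real.exp (l * (m / N)) * μ m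
  have hK : ∀ m ≤ N, Q0 * (μ m + ∑ i ∈ Finset.range m, μ (m - i) * K i) ≤ K m := by
    intro m hm
    have hE : 1 ≤ Real.exp (l * (m / N)) := Real.one_le_exp (by positivity)
    have hrw : ∑ i ∈ Finset.range m, μ (m - i) * K i =
        κ * Real.exp (l * (m / N)) * C ^ 2 * ∑ i ∈ Finset.range m,
          Real.exp (-(l * ((m - i : ℕ) / N))) * rpowIncr σ N (m - i) * rpowIncr σ N i := by
      rw [Finset.mul_sum]
      refine Finset.sum_congr rfl fun i hi ↦ ?_
      have hexp : Real.exp (l * (i / N)) =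
          Real.exp (l * (m / N)) * Real.exp (-(l * ((m - i : ℕ) / N))) := by
        rw [← Real.exp_add, Nat.cast_sub (Finset.mem_range.1 hi).le]
        congr 1
        ring
      simp only [K, μ, hexp]
      ring
    have hQ : Q0 * (1 / (2 * C * (Q0 + 1)) * C) ≤ 1 / 2 := by
      rw [show Q0 * (1 / (2 * C * (Q0 + 1)) * C) = Q0 / (2 * (Q0 + 1)) by field_simp,
        div_le_div_iff₀ (by positivity) two_pos]
      linarith
    have hμm := hμ m
    calc Q0 * (μ m + ∑ i ∈ Finset.range m, μ (m - i) * K i)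
        ≤ Q0 * (Real.exp (l * (m / N)) * μ m + κ * Real.exp (l * (m / N)) * C ^ 2 *
            (1 / (2 * C * (Q0 + 1)) * rpowIncr σ N m)) := by
          rw [hrw]
          gcongr
          · exact le_mul_of_one_le_left hμm hE
          · exact hconv N m hN hm
      _ = (Q0 + κ * (Q0 * (1 / (2 * C * (Q0 + 1)) * C))) * (Real.exp (l * (m / N)) * μ m) := by
          simp only [μ]
          ring
      _ ≤ (Q0 + κ * (1 / 2)) * (Real.exp (l * (m / N)) * μ m) := by gcongr
      _ ≤ κ * (Real.exp (l * (m / N)) * μ m) := by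
          gcongr
          linarith
      _ = K m := by
          simp only [K]
          ring
  have hK0 : K 0 = 0 := by simp [K, μ, rpowIncr_zero]
  have hle := le_add_sum_of_le_add_conv hQ0 hμ hK0 hK hy
    (fun k hk ↦ by rw [← hsum z hk]; exact hzy k hk) n hn
  rw [hsum y hn, Finset.mul_sum]
  refine hle.trans ?_
  gcongr y n + ?_
  refine Finset.sum_le_sum fun j hj ↦ ?_
  have hj' := Finset.mem_range.1 hj
  have hyj := hy j (by omega)
  have hμj := hμ (n - j)
  rw [← mul_assoc]
  simp only [K]
  gcongr
  exact mul_le_of_le_one_right hl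
    ((div_le_one hN').2 (by exact_mod_cast (Nat.sub_le n j).trans hn))
end

section
/- Assume 0 < β < min(1, 2σ). There exists a constant Q > 0 depending only on σ, β, γ and T (but not on N or j) such that for every 2 ≤ j ≤ N one has Σ_{ℓ=1}^{j−1} ∫_{t_{ℓ−1}}^{t_ℓ} s^{−β} ( ∫_{s}^{t_ℓ} (t_j−θ)^{σ−1} dθ ) ds ≤ Q N^{−1} t_j^{σ−β}. -/
open MeasureTheory Set

/-- The Beta-type kernel `x ^ p * (c - x) ^ q` is integrable near its left endpoint. -/
lemma intervalIntegrable_rpow_mul_sub_rpow_left {p c : ℝ} (q : ℝ) (hp : -1 < p) (hc : 0 < c) :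
    IntervalIntegrable (fun x : ℝ => x ^ p * (c - x) ^ q) volume 0 (c / 2) := by
  refine (intervalIntegral.intervalIntegrable_rpow' hp).mul_continuousOn ?_
  rw [uIcc_of_le (by positivity)]
  refine ContinuousOn.rpow_const (by fun_prop) fun x hx => Or.inl ?_
  linarith [hx.2]

/-- The Beta-type kernel `x ^ p * (c - x) ^ q` is integrable on `[0, c]` for `p, q > -1`. -/
lemma intervalIntegrable_rpow_mul_sub_rpow {p q c : ℝ} (hp : -1 < p) (hq : -1 < q) (hc : 0 < c) :
    IntervalIntegrable (fun x : ℝ => x ^ p * (c - x) ^ q) volume 0 c := by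
  refine (intervalIntegrable_rpow_mul_sub_rpow_left q hp hc).trans ?_
  have h := (intervalIntegrable_rpow_mul_sub_rpow_left p hq hc).comp_sub_left c
  simp only [sub_sub_cancel, sub_zero, sub_half] at h
  simpa only [mul_comm] using h.symm

/-- Scaling of the Beta integral. -/
lemma integral_rpow_mul_sub_rpow_scaled (p q : ℝ) {c : ℝ} (hc : 0 < c) :
    ∫ x in (0 : ℝ)..c, x ^ p * (c - x) ^ q =
      c ^ (p + q + 1) * ∫ x in (0 : ℝ)..1, x ^ p * (1 - x) ^ q := by
  have h := intervalIntegral.mul_integral_comp_mul_left (a := 0) (b := 1)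
    (f := fun x : ℝ => x ^ p * (c - x) ^ q) c
  rw [mul_zero, mul_one] at h
  have hscale : ∫ x in (0 : ℝ)..1, (c * x) ^ p * (c - c * x) ^ q =
      ∫ x in (0 : ℝ)..1, c ^ (p + q) * (x ^ p * (1 - x) ^ q) := by
    refine intervalIntegral.integral_congr fun x hx => ?_
    rw [uIcc_of_le zero_le_one] at hx
    rw [show c - c * x = c * (1 - x) by ring, Real.mul_rpow hc.le hx.1,
      Real.mul_rpow hc.le (sub_nonneg.2 hx.2), Real.rpow_add hc]
    ring
  rw [← h, hscale, intervalIntegral.integral_const_mul, Real.rpow_add_one hc.ne']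
  ring

/-- On a cell `[a, b]` no longer than its distance to `c`, the iterated integral is bounded by the
cell length times the integral of the Beta-type kernel. -/
lemma integral_rpow_mul_integral_sub_rpow_le {σ β a b c : ℝ} (hσ0 : 0 < σ) (hσ1 : σ < 1)
    (hβ1 : β < 1) (ha : 0 ≤ a) (hab : a ≤ b) (hbc : b < c) (habc : b - a ≤ c - b) :
    ∫ s in a..b, s ^ (-β) * ∫ θ in s..b, (c - θ) ^ (σ - 1) ≤
      (b - a) * 2 ^ (1 - σ) * ∫ s in a..b, s ^ (-β) * (c - s) ^ (σ - 1) := by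
  have hc : 0 < c := by linarith
  rw [← intervalIntegral.integral_const_mul]
  refine (Real.le_norm_self _).trans (intervalIntegral.norm_integral_le_of_norm_le hab
    (Filter.Eventually.of_forall fun s hs => ?_) ?_)
  · have hs0 : 0 < s := ha.trans_lt hs.1
    have hinner : ‖∫ θ in s..b, (c - θ) ^ (σ - 1)‖ ≤ (c - b) ^ (σ - 1) * |b - s| := by
      refine intervalIntegral.norm_integral_le_of_norm_le_const fun θ hθ => ?_
      rw [uIoc_of_le hs.2] at hθ
      rw [Real.norm_of_nonneg (Real.rpow_nonneg (by linarith [hθ.2]) _)]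
      exact Real.rpow_le_rpow_of_nonpos (by linarith) (by linarith [hθ.2]) (by linarith)
    have hker : (c - b) ^ (σ - 1) ≤ 2 ^ (1 - σ) * (c - s) ^ (σ - 1) := by
      calc (c - b) ^ (σ - 1) ≤ ((c - s) / 2) ^ (σ - 1) :=
            Real.rpow_le_rpow_of_nonpos (by linarith [hs.2]) (by linarith [hs.1]) (by linarith)
        _ = 2 ^ (1 - σ) * (c - s) ^ (σ - 1) := by
            rw [Real.div_rpow (by linarith [hs.2]) zero_le_two, div_eq_mul_inv,
              ← Real.rpow_neg zero_le_two, neg_sub, mul_comm]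
    rw [norm_mul, Real.norm_of_nonneg (Real.rpow_nonneg hs0.le _)]
    have hlen : |b - s| ≤ b - a := by
      rw [abs_of_nonneg (by linarith [hs.2])]
      linarith [hs.1]
    calc s ^ (-β) * ‖∫ θ in s..b, (c - θ) ^ (σ - 1)‖
        ≤ s ^ (-β) * ((2 ^ (1 - σ) * (c - s) ^ (σ - 1)) * (b - a)) := by
          gcongr
          exact hinner.trans (mul_le_mul hker hlen (abs_nonneg _)
            ((Real.rpow_nonneg (by linarith) _).trans hker))
      _ = (b - a) * 2 ^ (1 - σ) * (s ^ (-β) * (c - s) ^ (σ - 1)) := by ring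
  · refine ((intervalIntegrable_rpow_mul_sub_rpow (by linarith) (by linarith) hc).mono_set
      ?_).const_mul _
    rw [uIcc_of_le hab, uIcc_of_le hc.le]
    exact Icc_subset_Icc ha hbc.le

/-- On `[0, 1]` the power function of exponent `γ ≥ 1` is Lipschitz with constant `γ`. -/
lemma rpow_sub_rpow_le_mul_sub {γ x y : ℝ} (hγ : 1 ≤ γ) (hx : 0 ≤ x) (hxy : x ≤ y) (hy : y ≤ 1) :
    y ^ γ - x ^ γ ≤ γ * (y - x) := by
  rcases (hx.trans hxy).eq_or_lt with rfl | hy0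
  · obtain rfl : x = 0 := le_antisymm hxy hx
    simp
  have hbern := one_add_mul_self_le_rpow_one_add (s := x / y - 1)
    (by linarith [div_nonneg hx hy0.le]) hγ
  rw [add_sub_cancel, Real.div_rpow hx hy0.le, le_div_iff₀ (Real.rpow_pos_of_pos hy0 _)] at hbern
  have hpow : y ^ γ = y ^ (γ - 1) * y := by
    rw [← Real.rpow_add_one hy0.ne', sub_add_cancel]
  have hle : y ^ (γ - 1) ≤ 1 := Real.rpow_le_one hy0.le hy (by linarith)
  have hexp : (1 + γ * (x / y - 1)) * y ^ γ = y ^ γ - y ^ (γ - 1) * (γ * (y - x)) := by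
    rw [hpow]
    field_simp
    ring
  have hnn : 0 ≤ γ * (y - x) := mul_nonneg (by linarith) (by linarith)
  nlinarith

/-- Consecutive equidistant increments of `x ↦ x ^ γ`, `γ ≥ 1`, are nondecreasing. -/
lemma rpow_increment_le {γ x h : ℝ} (hγ : 1 ≤ γ) (hx : 0 ≤ x) (hh : 0 < h) :
    (x + h) ^ γ - x ^ γ ≤ (x + h + h) ^ γ - (x + h) ^ γ := by
  have hs := (convexOn_rpow hγ).slope_mono_adjacent (x := x) (y := x + h) (z := x + h + h)
    hx (show (0 : ℝ) ≤ x + h + h by positivity) (by linarith) (by linarith)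
  simp only [add_sub_cancel_left] at hs
  exact (div_le_div_iff_of_pos_right hh).1 hs


/-- Assume `0 < β < min(1, 2σ)`. There exists `Q > 0` depending
only on `σ`, `β`, `γ` and `T` (but not on `N` or `j`) such that for every
`2 ≤ j ≤ N` (graded mesh `t_n = T(n/N)^γ`) one has
`Σ_{ℓ=1}^{j−1} ∫_{t_{ℓ−1}}^{t_ℓ} s^{−β} ( ∫_{s}^{t_ℓ} (t_j−θ)^{σ−1} dθ ) ds ≤ Q N^{−1} t_j^{σ−β}`. -/
theorem quadrature_error_R21_bound
    (σ β γ T : ℝ) (hσ0 : 0 < σ) (hσ1 : σ < 1)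
    (hβ0 : 0 < β) (hβ1 : β < min 1 (2 * σ)) (hγ : 1 ≤ γ) (hT : 0 < T) :
    ∃ Q > 0, ∀ N : ℕ, 1 ≤ N → ∀ t : ℕ → ℝ,
      (∀ n : ℕ, n ≤ N → t n = T * ((n : ℝ) / (N : ℝ)) ^ γ) →
      ∀ j : ℕ, 2 ≤ j → j ≤ N →
        ∑ l ∈ Finset.Icc 1 (j - 1),
          ∫ s in (t (l - 1))..(t l),
            s ^ (-β) * ∫ θ in s..(t l), (t j - θ) ^ (σ - 1)
        ≤ Q * (N : ℝ)⁻¹ * (t j) ^ (σ - β) := by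
  have hβ : β < 1 := hβ1.trans_le (min_le_left _ _)
  set B : ℝ := ∫ x in (0 : ℝ)..1, x ^ (-β) * (1 - x) ^ (σ - 1)
  have hB : 0 ≤ B := intervalIntegral.integral_nonneg zero_le_one fun x hx =>
    mul_nonneg (Real.rpow_nonneg hx.1 _) (Real.rpow_nonneg (sub_nonneg.2 hx.2) _)
  refine ⟨T * γ * 2 ^ (1 - σ) * (B + 1), by positivity, fun N hN t ht j hj2 hjN => ?_⟩
  have hN0 : (0 : ℝ) < N := by exact_mod_cast hN
  have hlt : ∀ m n : ℕ, m < n → n ≤ N → t m < t n := fun m n hmn hn => by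
    rw [ht m (hmn.le.trans hn), ht n hn]
    gcongr
  have hnn : ∀ n : ℕ, n ≤ N → 0 ≤ t n := fun n hn => by
    rw [ht n hn]
    positivity
  have ht0 : t 0 = 0 := by
    rw [ht 0 (Nat.zero_le _)]
    simp [Real.zero_rpow (by linarith : γ ≠ 0)]
  have hstep : ∀ k : ℕ, k + 1 ≤ N → t (k + 1) - t k ≤ T * γ * (N : ℝ)⁻¹ := fun k hk => by
    have h := rpow_sub_rpow_le_mul_sub (x := (k : ℝ) / N) (y := ((k + 1 : ℕ) : ℝ) / N) hγ
      (by positivity) (by gcongr; omega) ((div_le_one hN0).2 (by exact_mod_cast hk))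
    have hsub : ((k + 1 : ℕ) : ℝ) / N - (k : ℝ) / N = (N : ℝ)⁻¹ := by
      push_cast
      ring
    rw [hsub] at h
    rw [ht _ hk, ht k (by omega), ← mul_sub, mul_assoc]
    gcongr
  have hincr : ∀ k : ℕ, k + 2 ≤ N → t (k + 1) - t k ≤ t (k + 2) - t (k + 1) := fun k hk => by
    have h := rpow_increment_le (x := (k : ℝ) / N) (h := (N : ℝ)⁻¹) hγ (by positivity)
      (by positivity)
    have h1 : ((k + 1 : ℕ) : ℝ) / N = (k : ℝ) / N + (N : ℝ)⁻¹ := by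
      push_cast
      ring
    have h2 : ((k + 2 : ℕ) : ℝ) / N = (k : ℝ) / N + (N : ℝ)⁻¹ + (N : ℝ)⁻¹ := by
      push_cast
      ring
    rw [ht _ hk, ht (k + 1) (by omega), ht k (by omega), ← mul_sub, ← mul_sub, h1, h2]
    gcongr
  have htj : 0 < t j := ht0 ▸ hlt 0 j (by omega) hjN
  have hint := intervalIntegrable_rpow_mul_sub_rpow (p := -β) (q := σ - 1) (by linarith)
    (by linarith) htj
  have hsub : ∀ a b : ℝ, 0 ≤ a → a ≤ b → b ≤ t j →
      IntervalIntegrable (fun x : ℝ => x ^ (-β) * (t j - x) ^ (σ - 1)) volume a b :=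
    fun a b ha hab hb => hint.mono_set (by
      rw [uIcc_of_le hab, uIcc_of_le htj.le]
      exact Icc_subset_Icc ha hb)
  have hker : ∀ a b : ℝ, 0 ≤ a → a ≤ b → b ≤ t j →
      0 ≤ ∫ x in a..b, x ^ (-β) * (t j - x) ^ (σ - 1) := fun a b ha hab hb =>
    intervalIntegral.integral_nonneg hab fun x hx => mul_nonneg
      (Real.rpow_nonneg (ha.trans hx.1) _) (Real.rpow_nonneg (by linarith [hx.2]) _)
  have hlast : t (j - 1) < t j := hlt _ _ (by omega) hjN
  have hlast0 : 0 ≤ t (j - 1) := hnn _ (by omega)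
  rw [← Finset.Ico_add_one_right_eq_Icc, Finset.sum_Ico_eq_sum_range, add_tsub_cancel_right]
  calc ∑ k ∈ Finset.range (j - 1), ∫ s in (t (1 + k - 1))..(t (1 + k)),
          s ^ (-β) * ∫ θ in s..(t (1 + k)), (t j - θ) ^ (σ - 1)
      ≤ ∑ k ∈ Finset.range (j - 1), T * γ * (N : ℝ)⁻¹ * 2 ^ (1 - σ) *
          ∫ s in (t k)..(t (k + 1)), s ^ (-β) * (t j - s) ^ (σ - 1) := by
        refine Finset.sum_le_sum fun k hk => ?_
        have hkj : k + 2 ≤ j := by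
          have := Finset.mem_range.1 hk
          omega
        have hnext : t (k + 2) ≤ t j := by
          rcases hkj.eq_or_lt with h | h
          · rw [h]
          · exact (hlt _ _ h hjN).le
        have hk0 := hnn k (by omega)
        have hk1 := hlt k (k + 1) (by omega) (by omega)
        have hk2 := hlt (k + 1) j (by omega) hjN
        rw [add_tsub_cancel_left, add_comm 1 k]
        refine (integral_rpow_mul_integral_sub_rpow_le hσ0 hσ1 hβ hk0 hk1.le hk2
          (by linarith [hincr k (by omega)])).trans ?_
        refine mul_le_mul_of_nonneg_right ?_ (hker _ _ hk0 hk1.le hk2.le)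
        exact mul_le_mul_of_nonneg_right (hstep k (by omega)) (by positivity)
    _ = T * γ * (N : ℝ)⁻¹ * 2 ^ (1 - σ) *
          ∫ s in (0 : ℝ)..(t (j - 1)), s ^ (-β) * (t j - s) ^ (σ - 1) := by
        rw [← Finset.mul_sum, intervalIntegral.sum_integral_adjacent_intervals, ht0]
        exact fun k hk => hsub _ _ (hnn k (by omega)) (hlt _ _ (by omega) (by omega)).le
          (hlt _ _ (by omega) hjN).le
    _ ≤ T * γ * (N : ℝ)⁻¹ * 2 ^ (1 - σ) *
          ∫ s in (0 : ℝ)..(t j), s ^ (-β) * (t j - s) ^ (σ - 1) := by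
        gcongr
        rw [← intervalIntegral.integral_add_adjacent_intervals
          (hsub 0 _ le_rfl hlast0 hlast.le) (hsub _ _ hlast0 hlast.le le_rfl)]
        exact le_add_of_nonneg_right (hker _ _ hlast0 hlast.le le_rfl)
    _ = T * γ * (N : ℝ)⁻¹ * 2 ^ (1 - σ) * (t j ^ (σ - β) * B) := by
        rw [integral_rpow_mul_sub_rpow_scaled _ _ htj, show -β + (σ - 1) + 1 = σ - β by ring]
    _ ≤ T * γ * (N : ℝ)⁻¹ * 2 ^ (1 - σ) * (t j ^ (σ - β) * (B + 1)) := by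
        gcongr
        linarith
    _ = T * γ * 2 ^ (1 - σ) * (B + 1) * (N : ℝ)⁻¹ * t j ^ (σ - β) := by ring
end

section
/- Assume 0 < β < min(1, 2σ). There exists a constant Q > 0 depending only on σ, β, γ and T (but not on N or j) such that for every 1 ≤ j ≤ N one has ∫_{t_{j−1}}^{t_j} s^{−β} (t_j − s)^{σ} ds ≤ Q N^{−1} t_j^{σ−β}. -/
open Real in
/-- The increments of a graded mesh with `N` steps are at most `γ T / N`. -/
theorem graded_mesh_step_le {γ T : ℝ} (hγ : 1 ≤ γ) (hT : 0 ≤ T) {N j : ℕ} (hj : 1 ≤ j)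
    (hjN : j ≤ N) :
    T * ((j : ℝ) / N) ^ γ - T * (((j - 1 : ℕ) : ℝ) / N) ^ γ ≤ T * γ * (N : ℝ)⁻¹ := by
  have hj' : (1 : ℝ) ≤ j := by exact_mod_cast hj
  have hjN' : (j : ℝ) ≤ N := by exact_mod_cast hjN
  have hj0 : (0 : ℝ) < j := by linarith
  have hN0 : (0 : ℝ) < N := by linarith
  have hinv : (j : ℝ)⁻¹ ≤ 1 := inv_le_one_of_one_le₀ hj'
  have bernoulli := one_add_mul_self_le_rpow_one_add (s := -(j : ℝ)⁻¹) (by linarith) hγ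
  have hsplit : ((j - 1 : ℕ) : ℝ) / N = ((j : ℝ) / N) * (1 + -(j : ℝ)⁻¹) := by
    rw [Nat.cast_sub hj]
    field_simp
    push_cast
    ring
  have hle : ((j : ℝ) / N) ^ γ ≤ (j : ℝ) / N :=
    rpow_le_self_of_le_one (by positivity) ((div_le_one hN0).2 hjN') hγ
  rw [hsplit, mul_rpow (by positivity) (by linarith)]
  calc T * ((j : ℝ) / N) ^ γ - T * (((j : ℝ) / N) ^ γ * (1 + -(j : ℝ)⁻¹) ^ γ)
      = T * (((j : ℝ) / N) ^ γ * (1 - (1 + -(j : ℝ)⁻¹) ^ γ)) := by ring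
    _ ≤ T * (((j : ℝ) / N) ^ γ * (γ * (j : ℝ)⁻¹)) := by
        gcongr
        linarith
    _ ≤ T * ((j : ℝ) / N * (γ * (j : ℝ)⁻¹)) := by gcongr
    _ = T * γ * (N : ℝ)⁻¹ := by field_simp

open Real in
/-- Increments of the concave power `x ↦ x ^ (1 - β)` on `[0, b]`. -/
theorem rpow_one_sub_sub_le {a b β : ℝ} (ha : 0 ≤ a) (hab : a ≤ b) (hb : 0 < b)
    (hβ0 : 0 ≤ β) :
    b ^ (1 - β) - a ^ (1 - β) ≤ b ^ (-β) * (b - a) := by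
  have hle : a / b ≤ (a / b) ^ (1 - β) :=
    self_le_rpow_of_le_one (by positivity) ((div_le_one hb).2 hab) (by linarith)
  have hpow : b ^ (1 - β) = b ^ (-β) * b := by
    rw [← rpow_add_one hb.ne']
    ring_nf
  have ha_pow : a ^ (1 - β) = b ^ (1 - β) * (a / b) ^ (1 - β) := by
    rw [← mul_rpow hb.le (by positivity), mul_div_cancel₀ _ hb.ne']
  calc b ^ (1 - β) - a ^ (1 - β) = b ^ (1 - β) * (1 - (a / b) ^ (1 - β)) := by
        rw [ha_pow]
        ring
    _ ≤ b ^ (1 - β) * (1 - a / b) := by gcongr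
    _ = b ^ (-β) * (b - a) := by
        rw [hpow]
        field_simp

open Real in
/-- A weakly singular integral over an interval ending at `b` is controlled by its length. -/
theorem integral_rpow_neg_mul_sub_rpow_le {a b β σ : ℝ} (ha : 0 ≤ a) (hab : a ≤ b) (hb : 0 < b)
    (hβ0 : 0 ≤ β) (hβ1 : β < 1) (hσ : 0 ≤ σ) :
    ∫ s in a..b, s ^ (-β) * (b - s) ^ σ ≤ (b - a) / (1 - β) * b ^ (σ - β) := by
  have hint : IntervalIntegrable (fun s : ℝ => s ^ (-β)) MeasureTheory.volume a b :=
    intervalIntegral.intervalIntegrable_rpow' (by linarith)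
  have hcont : Continuous fun s : ℝ => (b - s) ^ σ :=
    (continuous_const.sub continuous_id).rpow_const fun _ => Or.inr hσ
  have hβ : 0 < 1 - β := by linarith
  calc ∫ s in a..b, s ^ (-β) * (b - s) ^ σ
      ≤ ∫ s in a..b, s ^ (-β) * b ^ σ := by
        refine intervalIntegral.integral_mono_on hab (hint.mul_continuousOn hcont.continuousOn)
          (hint.mul_const _) fun s hs => ?_
        have hs0 : 0 ≤ s := ha.trans hs.1
        exact mul_le_mul_of_nonneg_left
          (rpow_le_rpow (by linarith [hs.2]) (by linarith) hσ) (rpow_nonneg hs0 _)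
    _ = (b ^ (1 - β) - a ^ (1 - β)) / (1 - β) * b ^ σ := by
        rw [intervalIntegral.integral_mul_const, integral_rpow (Or.inl (by linarith)),
          neg_add_eq_sub]
    _ ≤ b ^ (-β) * (b - a) / (1 - β) * b ^ σ := by
        gcongr
        exact rpow_one_sub_sub_le ha hab hb hβ0
    _ = (b - a) / (1 - β) * b ^ (σ - β) := by
        rw [sub_eq_add_neg σ β, rpow_add hb]
        ring


/-- Assume `0 < β < min(1, 2σ)`. There exists `Q > 0` depending
only on `σ`, `β`, `γ` and `T` (but not on `N` or `j`) such that for every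
`1 ≤ j ≤ N` (graded mesh `t_n = T(n/N)^γ`) one has
`∫_{t_{j−1}}^{t_j} s^{−β} (t_j − s)^{σ} ds ≤ Q N^{−1} t_j^{σ−β}`. -/
theorem quadrature_error_R22_bound
    (σ β γ T : ℝ) (hσ0 : 0 < σ) (hσ1 : σ < 1)
    (hβ0 : 0 < β) (hβ1 : β < min 1 (2 * σ)) (hγ : 1 ≤ γ) (hT : 0 < T) :
    ∃ Q > 0, ∀ N : ℕ, 1 ≤ N → ∀ t : ℕ → ℝ,
      (∀ n : ℕ, n ≤ N → t n = T * ((n : ℝ) / (N : ℝ)) ^ γ) →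
      ∀ j : ℕ, 1 ≤ j → j ≤ N →
        ∫ s in (t (j - 1))..(t j), s ^ (-β) * (t j - s) ^ σ
        ≤ Q * (N : ℝ)⁻¹ * (t j) ^ (σ - β) := by
  have hβ1' : β < 1 := hβ1.trans_le (min_le_left _ _)
  have hβ : 0 < 1 - β := by linarith
  refine ⟨T * γ / (1 - β), by positivity, fun N hN t ht j hj hjN => ?_⟩
  have hb : t j = T * ((j : ℝ) / N) ^ γ := ht j hjN
  have ha : t (j - 1) = T * (((j - 1 : ℕ) : ℝ) / N) ^ γ := ht _ (by omega)
  have hN0 : (0 : ℝ) < N := by exact_mod_cast hN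
  have hj0 : (0 : ℝ) < j := by exact_mod_cast hj
  have hb_pos : 0 < t j := by rw [hb]; positivity
  have ha_nonneg : 0 ≤ t (j - 1) := by rw [ha]; positivity
  have hab : t (j - 1) ≤ t j := by
    rw [ha, hb]
    gcongr
    exact Nat.sub_le j 1
  have hstep : t j - t (j - 1) ≤ T * γ * (N : ℝ)⁻¹ := by
    rw [ha, hb]
    exact graded_mesh_step_le hγ hT.le hj hjN
  calc ∫ s in (t (j - 1))..(t j), s ^ (-β) * (t j - s) ^ σ
      ≤ (t j - t (j - 1)) / (1 - β) * t j ^ (σ - β) :=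
        integral_rpow_neg_mul_sub_rpow_le ha_nonneg hab hb_pos hβ0.le hβ1' hσ0.le
    _ ≤ T * γ * (N : ℝ)⁻¹ / (1 - β) * t j ^ (σ - β) := by gcongr
    _ = T * γ / (1 - β) * (N : ℝ)⁻¹ * t j ^ (σ - β) := by ring
end

section
/- For every 2 ≤ n ≤ N one has Σ_{k=2}^{n} ∫_{t_{k−1}}^{t_k} (t_n − t)^{−σ} ( (1/τ_k) ∫_{t_{k−1}}^{t_k} s^{σ−1} ds ) dt ≤ Q, where Q > 0 depends only on σ and γ (but not on n, N or T). In particular the sum is bounded by a constant multiple of ∫_0^{t_n} (t_n − t)^{−σ} t^{σ−1} dt = Γ(σ)Γ(1−σ). -/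
open intervalIntegral

/-- The mean value of `u ^ (σ - 1)` over `[p, q]` is at most its value at the left end point. -/
lemma average_rpow_le {σ p q : ℝ} (hσ0 : 0 < σ) (hσ1 : σ < 1) (hp : 0 < p) (hpq : p < q) :
    (1 / (q - p)) * ∫ u in p..q, u ^ (σ - 1) ≤ p ^ (σ - 1) := by
  have hmono : ∫ u in p..q, u ^ (σ - 1) ≤ ∫ _ in p..q, p ^ (σ - 1) :=
    integral_mono_on hpq.le (intervalIntegrable_rpow' (by linarith)) intervalIntegrable_const
      fun u hu => Real.rpow_le_rpow_of_nonpos hp hu.1 (by linarith)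
  rw [integral_const, smul_eq_mul] at hmono
  have hd : 0 < q - p := sub_pos.2 hpq
  rw [one_div, inv_mul_le_iff₀ hd]
  exact hmono

/-- If `q ≤ c * p`, then `p ^ (σ - 1)` is at most `c ^ (1 - σ) * s ^ (σ - 1)` for `s ∈ (0, q]`. -/
lemma rpow_left_le_mul_rpow {σ c p q s : ℝ} (hσ1 : σ < 1) (hc : 0 < c) (hp : 0 < p)
    (hs : 0 < s) (hsq : s ≤ q) (hq : q ≤ c * p) :
    p ^ (σ - 1) ≤ c ^ (1 - σ) * s ^ (σ - 1) := by
  have h : (c * p) ^ (σ - 1) ≤ s ^ (σ - 1) :=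
    Real.rpow_le_rpow_of_nonpos hs (hsq.trans hq) (by linarith)
  rw [Real.mul_rpow hc.le hp.le] at h
  calc p ^ (σ - 1) = c ^ (1 - σ) * (c ^ (σ - 1) * p ^ (σ - 1)) := by
        rw [← mul_assoc, ← Real.rpow_add hc]; simp
    _ ≤ c ^ (1 - σ) * s ^ (σ - 1) := by gcongr

/-- A majorant of the Beta integrand `(a - s) ^ (-σ) * s ^ (σ - 1)` that separates the two
singularities. -/
noncomputable def betaMajorant (σ a s : ℝ) : ℝ :=
  (a / 2) ^ (-σ) * s ^ (σ - 1) + (a / 2) ^ (σ - 1) * (a - s) ^ (-σ)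

lemma betaMajorant_nonneg {σ a s : ℝ} (hs : 0 ≤ s) (hsa : s ≤ a) : 0 ≤ betaMajorant σ a s := by
  have h1 : 0 ≤ a - s := sub_nonneg.2 hsa
  have h2 : 0 ≤ a := hs.trans hsa
  unfold betaMajorant
  positivity

lemma mul_rpow_le_betaMajorant {σ a s : ℝ} (hσ0 : 0 < σ) (hσ1 : σ < 1) (hs : 0 < s)
    (hsa : s < a) : (a - s) ^ (-σ) * s ^ (σ - 1) ≤ betaMajorant σ a s := by
  have h1 : 0 < a - s := sub_pos.2 hsa
  have h2 : 0 < a := hs.trans hsa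
  unfold betaMajorant
  rcases le_total s (a / 2) with h | h
  · have h3 : (a - s) ^ (-σ) ≤ (a / 2) ^ (-σ) :=
      Real.rpow_le_rpow_of_nonpos (by positivity) (by linarith) (by linarith)
    have h4 : 0 ≤ (a / 2) ^ (σ - 1) * (a - s) ^ (-σ) := by positivity
    have h5 := mul_le_mul_of_nonneg_right h3 (Real.rpow_nonneg hs.le (σ - 1))
    linarith
  · have h3 : s ^ (σ - 1) ≤ (a / 2) ^ (σ - 1) :=
      Real.rpow_le_rpow_of_nonpos (by positivity) h (by linarith)
    have h4 : 0 ≤ (a / 2) ^ (-σ) * s ^ (σ - 1) := by positivity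
    have h5 := mul_le_mul_of_nonneg_right h3 (Real.rpow_nonneg h1.le (-σ))
    linarith

lemma intervalIntegrable_sub_rpow {r : ℝ} (hr : -1 < r) (a p q : ℝ) :
    IntervalIntegrable (fun s => (a - s) ^ r) MeasureTheory.volume p q := by
  have h := (intervalIntegrable_rpow' (a := a - p) (b := a - q) hr).comp_sub_left a
  simpa using h

lemma intervalIntegrable_betaMajorant {σ : ℝ} (hσ0 : 0 < σ) (hσ1 : σ < 1) (a p q : ℝ) :
    IntervalIntegrable (betaMajorant σ a) MeasureTheory.volume p q :=
  ((intervalIntegrable_rpow' (by linarith)).const_mul _).add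
    ((intervalIntegrable_sub_rpow (by linarith) a p q).const_mul _)

lemma integral_betaMajorant {σ a : ℝ} (hσ0 : 0 < σ) (hσ1 : σ < 1) (ha : 0 < a) :
    ∫ s in (0)..a, betaMajorant σ a s = 2 ^ σ / σ + 2 ^ (1 - σ) / (1 - σ) := by
  unfold betaMajorant
  rw [integral_add ((intervalIntegrable_rpow' (by linarith)).const_mul _)
    ((intervalIntegrable_sub_rpow (by linarith) a 0 a).const_mul _),
    integral_const_mul, integral_const_mul,
    integral_comp_sub_left (fun s => s ^ (-σ)) a, sub_self, sub_zero,
    integral_rpow (Or.inl (by linarith)), integral_rpow (Or.inl (by linarith)),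
    sub_add_cancel, neg_add_eq_sub, Real.zero_rpow hσ0.ne', Real.zero_rpow (by linarith),
    sub_zero, sub_zero, Real.div_rpow ha.le zero_le_two, Real.div_rpow ha.le zero_le_two]
  have e1 : a ^ (-σ) * a ^ σ = 1 := by rw [← Real.rpow_add ha]; simp
  have e2 : a ^ (σ - 1) * a ^ (1 - σ) = 1 := by rw [← Real.rpow_add ha]; simp
  have e3 : ((2 : ℝ) ^ (-σ))⁻¹ = 2 ^ σ := by rw [← Real.rpow_neg zero_le_two, neg_neg]
  have e4 : ((2 : ℝ) ^ (σ - 1))⁻¹ = 2 ^ (1 - σ) := by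
    rw [← Real.rpow_neg zero_le_two, neg_sub]
  simp only [div_eq_mul_inv, e3, e4]
  linear_combination (2 ^ σ * σ⁻¹) * e1 + (2 ^ (1 - σ) * (1 - σ)⁻¹) * e2

/-- The contribution of one mesh interval is controlled by the integral of the majorant. -/
lemma integral_mul_average_le {σ c a p q : ℝ} (hσ0 : 0 < σ) (hσ1 : σ < 1) (hc : 0 < c)
    (hp : 0 < p) (hpq : p < q) (hqa : q ≤ a) (hq : q ≤ c * p) :
    ∫ s in p..q, (a - s) ^ (-σ) * ((1 / (q - p)) * ∫ u in p..q, u ^ (σ - 1)) ≤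
      c ^ (1 - σ) * ∫ s in p..q, betaMajorant σ a s := by
  rw [← integral_const_mul (c ^ (1 - σ))]
  refine integral_mono_on_of_le_Ioo hpq.le
    ((intervalIntegrable_sub_rpow (r := -σ) (by linarith) a p q).mul_const _)
    ((intervalIntegrable_betaMajorant hσ0 hσ1 a p q).const_mul _) fun s hs => ?_
  have hs0 : 0 < s := hp.trans hs.1
  have hsa : s < a := hs.2.trans_le hqa
  have h1 : 0 < a - s := sub_pos.2 hsa
  calc (a - s) ^ (-σ) * ((1 / (q - p)) * ∫ u in p..q, u ^ (σ - 1))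
      ≤ (a - s) ^ (-σ) * (c ^ (1 - σ) * s ^ (σ - 1)) := by
        refine mul_le_mul_of_nonneg_left ?_ (Real.rpow_nonneg h1.le _)
        exact (average_rpow_le hσ0 hσ1 hp hpq).trans
          (rpow_left_le_mul_rpow hσ1 hc hp hs0 hs.2.le hq)
    _ = c ^ (1 - σ) * ((a - s) ^ (-σ) * s ^ (σ - 1)) := by ring
    _ ≤ c ^ (1 - σ) * betaMajorant σ a s := by
        gcongr
        exact mul_rpow_le_betaMajorant hσ0 hσ1 hs0 hsa

lemma sum_Icc_two_integral {f : ℝ → ℝ} (hf : ∀ p q, IntervalIntegrable f MeasureTheory.volume p q)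
    (t : ℕ → ℝ) {n : ℕ} (hn : 1 ≤ n) :
    ∑ k ∈ Finset.Icc 2 n, ∫ s in (t (k - 1))..(t k), f s = ∫ s in (t 1)..(t n), f s := by
  induction n, hn using Nat.le_induction with
  | base => simp
  | succ n hn ih =>
    rw [Finset.sum_Icc_succ_top (by omega), ih, Nat.add_sub_cancel,
      integral_add_adjacent_intervals (hf _ _) (hf _ _)]

/-- For every `2 ≤ n ≤ N` one has
`Σ_{k=2}^{n} ∫_{t_{k−1}}^{t_k} (t_n − t)^{−σ} ((1/τ_k) ∫_{t_{k−1}}^{t_k} s^{σ−1} ds) dt ≤ Q`,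
where `Q > 0` depends only on `σ` and `γ` (but not on `n`, `N` or `T`), on the
graded mesh `t_n = T(n/N)^γ`. -/
theorem Xi2_contribution_bound
    (σ γ : ℝ) (hσ0 : 0 < σ) (hσ1 : σ < 1) (hγ : 1 ≤ γ) :
    ∃ Q > 0, ∀ T : ℝ, 0 < T → ∀ N : ℕ, 1 ≤ N → ∀ t : ℕ → ℝ,
      (∀ n : ℕ, n ≤ N → t n = T * ((n : ℝ) / (N : ℝ)) ^ γ) →
      ∀ n : ℕ, 2 ≤ n → n ≤ N →
        ∑ k ∈ Finset.Icc 2 n,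
          ∫ s in (t (k - 1))..(t k),
            (t n - s) ^ (-σ) *
              ((1 / (t k - t (k - 1))) * ∫ u in (t (k - 1))..(t k), u ^ (σ - 1))
        ≤ Q := by
  have hσ1' : 0 < 1 - σ := sub_pos.2 hσ1
  refine ⟨((2 : ℝ) ^ γ) ^ (1 - σ) * (2 ^ σ / σ + 2 ^ (1 - σ) / (1 - σ)), by positivity, ?_⟩
  intro T hT N hN t ht n hn hnN
  have hN0 : (0 : ℝ) < N := by exact_mod_cast hN
  have hpos : ∀ k, 1 ≤ k → k ≤ N → 0 < t k := fun k hk hkN => by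
    have hk0 : (0 : ℝ) < k := by exact_mod_cast hk
    rw [ht k hkN]
    positivity
  have hmono : ∀ j k, j ≤ k → k ≤ N → t j ≤ t k := fun j k hjk hkN => by
    rw [ht k hkN, ht j (hjk.trans hkN)]
    gcongr
  have hstrict : ∀ k, 1 ≤ k → k ≤ N → t (k - 1) < t k := fun k hk hkN => by
    have hlt : ((k - 1 : ℕ) : ℝ) < k := by exact_mod_cast Nat.sub_lt hk one_pos
    rw [ht k hkN, ht (k - 1) (by omega)]
    gcongr
  have hratio : ∀ k, 2 ≤ k → k ≤ N → t k ≤ 2 ^ γ * t (k - 1) := fun k hk hkN => by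
    have hle : (k : ℝ) ≤ 2 * ((k - 1 : ℕ) : ℝ) := by
      exact_mod_cast (by omega : k ≤ 2 * (k - 1))
    rw [ht k hkN, ht (k - 1) (by omega), mul_left_comm,
      ← Real.mul_rpow zero_le_two (by positivity), ← mul_div_assoc]
    gcongr
  have hint := intervalIntegrable_betaMajorant hσ0 hσ1 (t n)
  have hn0 : 0 < t n := hpos n (by omega) hnN
  have h1 : 0 < t 1 := hpos 1 le_rfl hN
  have h1n : t 1 ≤ t n := hmono 1 n (by omega) hnN
  calc _ ≤ ∑ k ∈ Finset.Icc 2 n,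
          ((2 : ℝ) ^ γ) ^ (1 - σ) * ∫ s in (t (k - 1))..(t k), betaMajorant σ (t n) s := by
        refine Finset.sum_le_sum fun k hk => ?_
        obtain ⟨hk2, hkn⟩ := Finset.mem_Icc.1 hk
        exact integral_mul_average_le hσ0 hσ1 (by positivity) (hpos (k - 1) (by omega) (by omega))
          (hstrict k (by omega) (by omega)) (hmono k n hkn hnN) (hratio k hk2 (by omega))
    _ = ((2 : ℝ) ^ γ) ^ (1 - σ) * ∫ s in (t 1)..(t n), betaMajorant σ (t n) s := by
        rw [← Finset.mul_sum, sum_Icc_two_integral hint t (by omega)]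
    _ ≤ ((2 : ℝ) ^ γ) ^ (1 - σ) * ∫ s in (0)..(t n), betaMajorant σ (t n) s := by
        gcongr
        rw [← integral_add_adjacent_intervals (hint 0 (t 1)) (hint (t 1) (t n))]
        exact le_add_of_nonneg_left (integral_nonneg h1.le fun s hs =>
          betaMajorant_nonneg hs.1 (hs.2.trans h1n))
    _ = _ := by rw [integral_betaMajorant hσ0 hσ1 hn0]
end

section
/- Let φ : [0,T] → ℝ be continuous on [0,T] and twice continuously differentiable on (0,T], with |φ′(t)| ≤ C t^{σ−1} and |φ″(t)| ≤ C t^{σ−2} for all t ∈ (0,T]. Then there exists Q > 0 depending only on C, σ, γ and T (but not on n or N) such that for every 1 ≤ n ≤ N, | Σ_{k=1}^{n} a^{(n)}_{n−k} (φ(t_k) − φ(t_{k−1})) − (1/Γ(1−σ)) ∫_0^{t_n} (t_n − s)^{−σ} φ′(s) ds | ≤ Q n^{−min(2−σ, γσ)}. -/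
open MeasureTheory

/-- The contribution of the cell `[u, v]` to `Γ(1 - σ)` times the truncation error at `b`. -/
noncomputable def localL1Error (σ b : ℝ) (φ φ' : ℝ → ℝ) (u v : ℝ) : ℝ :=
  ((b - u) ^ (1 - σ) - (b - v) ^ (1 - σ)) / (1 - σ) / (v - u) * (φ v - φ u) -
    ∫ s in u..v, (b - s) ^ (-σ) * φ' s

lemma intervalIntegrable_sub_rpow_neg {σ : ℝ} (hσ1 : σ < 1) (b u v : ℝ) :
    IntervalIntegrable (fun s => (b - s) ^ (-σ)) volume u v := by
  have h := (intervalIntegral.intervalIntegrable_rpow' (a := b - u) (b := b - v)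
    (r := -σ) (by linarith)).comp_sub_left b
  simpa using h

lemma integral_sub_rpow_neg {σ : ℝ} (hσ1 : σ < 1) (b u v : ℝ) :
    ∫ s in u..v, (b - s) ^ (-σ) = ((b - u) ^ (1 - σ) - (b - v) ^ (1 - σ)) / (1 - σ) := by
  rw [intervalIntegral.integral_comp_sub_left (fun x => x ^ (-σ)) b,
    integral_rpow (Or.inl (by linarith))]
  ring_nf

lemma localL1Error_eq_integral {σ b u v : ℝ} {φ φ' : ℝ → ℝ} (hσ1 : σ < 1)
    (hint : IntervalIntegrable (fun s => (b - s) ^ (-σ) * φ' s) volume u v) :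
    localL1Error σ b φ φ' u v =
      ∫ s in u..v, (b - s) ^ (-σ) * ((φ v - φ u) / (v - u) - φ' s) := by
  have h1 := (intervalIntegrable_sub_rpow_neg hσ1 b u v).mul_const ((φ v - φ u) / (v - u))
  simp only [mul_sub]
  rw [intervalIntegral.integral_sub h1 hint, intervalIntegral.integral_mul_const,
    integral_sub_rpow_neg hσ1, localL1Error]
  ring

lemma abs_slope_sub_deriv_le {φ φ' φ'' : ℝ → ℝ} {u v M : ℝ} (huv : u < v)
    (hφ : ∀ x ∈ Set.Icc u v, HasDerivAt φ (φ' x) x)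
    (hφ' : ∀ x ∈ Set.Icc u v, HasDerivAt φ' (φ'' x) x)
    (hM : ∀ x ∈ Set.Icc u v, |φ'' x| ≤ M) {s : ℝ} (hs : s ∈ Set.Icc u v) :
    |(φ v - φ u) / (v - u) - φ' s| ≤ M * (v - u) := by
  obtain ⟨c, hc, hc'⟩ := exists_hasDerivAt_eq_slope φ φ' huv
    (fun x hx => (hφ x hx).continuousAt.continuousWithinAt)
    (fun x hx => hφ x (Set.Ioo_subset_Icc_self hx))
  have hM0 : 0 ≤ M := (abs_nonneg _).trans (hM s hs)
  have hcI := Set.Ioo_subset_Icc_self hc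
  have h := Convex.norm_image_sub_le_of_norm_hasDerivWithin_le
    (fun x hx => (hφ' x hx).hasDerivWithinAt) hM (convex_Icc u v) hs hcI
  rw [← hc']
  refine h.trans (mul_le_mul_of_nonneg_left ?_ hM0)
  rw [Real.norm_eq_abs, abs_le]
  constructor <;> linarith [hs.1, hs.2, hcI.1, hcI.2]

lemma abs_localL1Error_le_of_lt {σ b u v M : ℝ} {φ φ' φ'' : ℝ → ℝ} (hσ0 : 0 < σ) (hσ1 : σ < 1)
    (huv : u < v) (hvb : v < b)
    (hφ : ∀ x ∈ Set.Icc u v, HasDerivAt φ (φ' x) x)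
    (hφ' : ∀ x ∈ Set.Icc u v, HasDerivAt φ' (φ'' x) x)
    (hM : ∀ x ∈ Set.Icc u v, |φ'' x| ≤ M) :
    |localL1Error σ b φ φ' u v| ≤
      M * (v - u) ^ 2 * ((b - v) ^ (-σ) - (b - u) ^ (-σ)) := by
  have hcont : ContinuousOn φ' (Set.uIcc u v) := by
    rw [Set.uIcc_of_le huv.le]
    exact fun x hx => (hφ' x hx).continuousAt.continuousWithinAt
  have hK := intervalIntegrable_sub_rpow_neg hσ1 b u v
  have hint := hK.mul_continuousOn hcont
  have hφ'i : IntervalIntegrable φ' volume u v := hcont.intervalIntegrable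
  have hzero : ∫ s in u..v, (b - u) ^ (-σ) * ((φ v - φ u) / (v - u) - φ' s) = 0 := by
    rw [intervalIntegral.integral_const_mul,
      intervalIntegral.integral_sub intervalIntegrable_const hφ'i,
      intervalIntegral.integral_eq_sub_of_hasDerivAt
        (fun x hx => hφ x (by rwa [Set.uIcc_of_le huv.le] at hx)) hφ'i,
      intervalIntegral.integral_const, smul_eq_mul]
    have : v - u ≠ 0 := by linarith
    field_simp
    ring
  rw [localL1Error_eq_integral hσ1 hint]
  have hi1 : IntervalIntegrable
      (fun s => (b - s) ^ (-σ) * ((φ v - φ u) / (v - u) - φ' s)) volume u v :=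
    hK.mul_continuousOn (continuousOn_const.sub hcont)
  have hi2 : IntervalIntegrable
      (fun s => (b - u) ^ (-σ) * ((φ v - φ u) / (v - u) - φ' s)) volume u v :=
    (intervalIntegrable_const.sub hφ'i).const_mul _
  rw [← sub_zero (∫ s in u..v, (b - s) ^ (-σ) * _), ← hzero,
    ← intervalIntegral.integral_sub hi1 hi2]
  have h := intervalIntegral.norm_integral_le_of_norm_le_const (a := u) (b := v)
    (f := fun s => (b - s) ^ (-σ) * ((φ v - φ u) / (v - u) - φ' s) -
      (b - u) ^ (-σ) * ((φ v - φ u) / (v - u) - φ' s))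
    (C := ((b - v) ^ (-σ) - (b - u) ^ (-σ)) * (M * (v - u))) ?_
  · rw [abs_of_pos (sub_pos.2 huv)] at h
    refine h.trans (le_of_eq (by ring))
  · intro s hs
    rw [Set.uIoc_of_le huv.le] at hs
    have hs' := Set.Ioc_subset_Icc_self hs
    have h1 : (b - u) ^ (-σ) ≤ (b - s) ^ (-σ) :=
      Real.rpow_le_rpow_of_nonpos (by linarith [hs.2]) (by linarith [hs.1]) (by linarith)
    have h2 : (b - s) ^ (-σ) ≤ (b - v) ^ (-σ) :=
      Real.rpow_le_rpow_of_nonpos (by linarith) (by linarith [hs.2]) (by linarith)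
    rw [← sub_mul, norm_mul, Real.norm_eq_abs, Real.norm_eq_abs, abs_of_nonneg (sub_nonneg.2 h1)]
    exact mul_le_mul (by linarith) (abs_slope_sub_deriv_le huv hφ hφ' hM hs') (abs_nonneg _)
      (by linarith)

lemma abs_localL1Error_right_le {σ u v M : ℝ} {φ φ' φ'' : ℝ → ℝ} (hσ1 : σ < 1)
    (huv : u < v)
    (hφ : ∀ x ∈ Set.Icc u v, HasDerivAt φ (φ' x) x)
    (hφ' : ∀ x ∈ Set.Icc u v, HasDerivAt φ' (φ'' x) x)
    (hM : ∀ x ∈ Set.Icc u v, |φ'' x| ≤ M) :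
    |localL1Error σ v φ φ' u v| ≤ M * (v - u) ^ (2 - σ) / (1 - σ) := by
  have hcont : ContinuousOn φ' (Set.uIcc u v) := by
    rw [Set.uIcc_of_le huv.le]
    exact fun x hx => (hφ' x hx).continuousAt.continuousWithinAt
  have hK := intervalIntegrable_sub_rpow_neg hσ1 v u v
  rw [localL1Error_eq_integral hσ1 (hK.mul_continuousOn hcont)]
  have h := intervalIntegral.norm_integral_le_of_norm_le (μ := volume) huv.le
    (f := fun s => (v - s) ^ (-σ) * ((φ v - φ u) / (v - u) - φ' s))
    (g := fun s => (v - s) ^ (-σ) * (M * (v - u))) (Filter.Eventually.of_forall ?_)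
    (hK.mul_const _)
  · rw [intervalIntegral.integral_mul_const, integral_sub_rpow_neg hσ1, sub_self,
      Real.zero_rpow (by linarith)] at h
    refine h.trans (le_of_eq ?_)
    rw [show 2 - σ = (1 - σ) + 1 by ring, Real.rpow_add_one (by linarith)]
    ring
  · intro s hs
    have h0 : 0 ≤ (v - s) ^ (-σ) := Real.rpow_nonneg (by linarith [hs.2]) _
    rw [norm_mul, Real.norm_eq_abs, Real.norm_eq_abs, abs_of_nonneg h0]
    exact mul_le_mul_of_nonneg_left
      (abs_slope_sub_deriv_le huv hφ hφ' hM (Set.Ioc_subset_Icc_self hs)) h0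

lemma integral_rpow_sub_one {σ : ℝ} (hσ0 : 0 < σ) (v : ℝ) :
    ∫ s in (0 : ℝ)..v, s ^ (σ - 1) = v ^ σ / σ := by
  rw [integral_rpow (Or.inl (by linarith)), sub_add_cancel, Real.zero_rpow hσ0.ne', sub_zero]

lemma intervalIntegrable_of_abs_le_rpow {σ C v : ℝ} {f : ℝ → ℝ} (hσ0 : 0 < σ) (hv : 0 ≤ v)
    (hf : ContinuousOn f (Set.Ioc 0 v)) (hC : ∀ x ∈ Set.Ioc 0 v, |f x| ≤ C * x ^ (σ - 1)) :
    IntervalIntegrable f volume 0 v := by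
  refine IntervalIntegrable.mono_fun'
    ((intervalIntegral.intervalIntegrable_rpow' (r := σ - 1) (by linarith)).const_mul C) ?_ ?_
  · rw [Set.uIoc_of_le hv]
    exact hf.aestronglyMeasurable measurableSet_Ioc
  · rw [Set.uIoc_of_le hv]
    exact (ae_restrict_mem measurableSet_Ioc).mono hC

lemma abs_sub_zero_le_of_abs_deriv_le {σ C v : ℝ} {φ φ' : ℝ → ℝ} (hσ0 : 0 < σ) (hv : 0 ≤ v)
    (hφc : ContinuousOn φ (Set.Icc 0 v)) (hφ : ∀ x ∈ Set.Ioc 0 v, HasDerivAt φ (φ' x) x)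
    (hφ' : ContinuousOn φ' (Set.Ioc 0 v)) (hC : ∀ x ∈ Set.Ioc 0 v, |φ' x| ≤ C * x ^ (σ - 1)) :
    |φ v - φ 0| ≤ C * (v ^ σ / σ) := by
  rw [← intervalIntegral.integral_eq_sub_of_hasDerivAt_of_le hv hφc
    (fun x hx => hφ x (Set.Ioo_subset_Ioc_self hx))
    (intervalIntegrable_of_abs_le_rpow hσ0 hv hφ' hC), ← integral_rpow_sub_one hσ0,
    ← intervalIntegral.integral_const_mul]
  exact intervalIntegral.norm_integral_le_of_norm_le (μ := volume) (f := φ') hv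
    (Filter.Eventually.of_forall hC)
    ((intervalIntegral.intervalIntegrable_rpow' (r := σ - 1) (by linarith)).const_mul C)

lemma rpow_mul_rpow_le_add {σ b s : ℝ} (hσ0 : 0 < σ) (hσ1 : σ < 1) (hs : s ∈ Set.Ioo 0 b) :
    (b - s) ^ (-σ) * s ^ (σ - 1) ≤
      (b / 2) ^ (-σ) * s ^ (σ - 1) + (b / 2) ^ (σ - 1) * (b - s) ^ (-σ) := by
  obtain ⟨h0, hb⟩ := hs
  have hb0 : 0 < b := h0.trans hb
  have p1 : 0 ≤ (b - s) ^ (-σ) := Real.rpow_nonneg (by linarith) _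
  have p2 : 0 ≤ s ^ (σ - 1) := Real.rpow_nonneg h0.le _
  have p3 : 0 ≤ (b / 2) ^ (-σ) := Real.rpow_nonneg (by linarith) _
  have p4 : 0 ≤ (b / 2) ^ (σ - 1) := Real.rpow_nonneg (by linarith) _
  rcases le_total s (b / 2) with h | h
  · have : (b - s) ^ (-σ) ≤ (b / 2) ^ (-σ) :=
      Real.rpow_le_rpow_of_nonpos (by linarith) (by linarith) (by linarith)
    nlinarith [mul_le_mul_of_nonneg_right this p2, mul_nonneg p4 p1]
  · have : s ^ (σ - 1) ≤ (b / 2) ^ (σ - 1) :=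
      Real.rpow_le_rpow_of_nonpos (by linarith) h (by linarith)
    nlinarith [mul_le_mul_of_nonneg_right this p1, mul_nonneg p3 p2]

lemma abs_kernel_mul_le {σ C b s : ℝ} {f : ℝ → ℝ} (hσ0 : 0 < σ) (hσ1 : σ < 1)
    (hC0 : 0 ≤ C) (hC : ∀ x ∈ Set.Ioc 0 b, |f x| ≤ C * x ^ (σ - 1)) (hs : s ∈ Set.Ioc 0 b) :
    ‖(b - s) ^ (-σ) * f s‖ ≤
      C * ((b / 2) ^ (-σ) * s ^ (σ - 1) + (b / 2) ^ (σ - 1) * (b - s) ^ (-σ)) := by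
  have h0 : 0 ≤ (b - s) ^ (-σ) := Real.rpow_nonneg (by linarith [hs.2]) _
  rw [norm_mul, Real.norm_eq_abs, Real.norm_eq_abs, abs_of_nonneg h0]
  rcases eq_or_lt_of_le hs.2 with h | h
  · subst h
    have hs0 : 0 < s := hs.1
    rw [sub_self, Real.zero_rpow (by linarith), zero_mul]
    positivity
  · have h1 := mul_le_mul_of_nonneg_left (rpow_mul_rpow_le_add hσ0 hσ1 ⟨hs.1, h⟩) hC0
    have h2 := mul_le_mul_of_nonneg_left (hC s hs) h0
    linarith

lemma intervalIntegrable_kernel_bound {σ : ℝ} (hσ0 : 0 < σ) (hσ1 : σ < 1) (C b : ℝ) :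
    IntervalIntegrable (fun s => C * ((b / 2) ^ (-σ) * s ^ (σ - 1) +
      (b / 2) ^ (σ - 1) * (b - s) ^ (-σ))) volume 0 b :=
  (((intervalIntegral.intervalIntegrable_rpow' (by linarith)).const_mul _).add
    ((intervalIntegrable_sub_rpow_neg hσ1 b 0 b).const_mul _)).const_mul C

lemma intervalIntegrable_kernel_mul {σ C b : ℝ} {f : ℝ → ℝ} (hσ0 : 0 < σ) (hσ1 : σ < 1)
    (hb : 0 ≤ b) (hC0 : 0 ≤ C) (hf : ContinuousOn f (Set.Ioc 0 b))
    (hC : ∀ x ∈ Set.Ioc 0 b, |f x| ≤ C * x ^ (σ - 1)) :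
    IntervalIntegrable (fun s => (b - s) ^ (-σ) * f s) volume 0 b := by
  refine IntervalIntegrable.mono_fun' (intervalIntegrable_kernel_bound hσ0 hσ1 C b) ?_ ?_
  · rw [Set.uIoc_of_le hb]
    have hm : Measurable fun s : ℝ => (b - s) ^ (-σ) := by fun_prop
    exact hm.aestronglyMeasurable.mul (hf.aestronglyMeasurable measurableSet_Ioc)
  · rw [Set.uIoc_of_le hb]
    exact (ae_restrict_mem measurableSet_Ioc).mono fun s hs => abs_kernel_mul_le hσ0 hσ1 hC0 hC hs

lemma abs_localL1Error_zero_le_of_lt {σ C b v : ℝ} {φ φ' : ℝ → ℝ} (hσ0 : 0 < σ) (hσ1 : σ < 1)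
    (hv : 0 < v) (hvb : v < b)
    (hφc : ContinuousOn φ (Set.Icc 0 v)) (hφ : ∀ x ∈ Set.Ioc 0 v, HasDerivAt φ (φ' x) x)
    (hφ' : ContinuousOn φ' (Set.Ioc 0 v)) (hC : ∀ x ∈ Set.Ioc 0 v, |φ' x| ≤ C * x ^ (σ - 1)) :
    |localL1Error σ b φ φ' 0 v| ≤ 2 * (C / σ) * (v ^ σ * (b - v) ^ (-σ)) := by
  have hd := abs_sub_zero_le_of_abs_deriv_le hσ0 hv.le hφc hφ hφ' hC
  have hk0 : 0 ≤ (b - v) ^ (-σ) := Real.rpow_nonneg (by linarith) _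
  have hk : ∀ s ∈ Set.Ioc 0 v, 0 ≤ (b - s) ^ (-σ) ∧ (b - s) ^ (-σ) ≤ (b - v) ^ (-σ) :=
    fun s hs => ⟨Real.rpow_nonneg (by linarith [hs.2]) _,
      Real.rpow_le_rpow_of_nonpos (by linarith) (by linarith [hs.2]) (by linarith)⟩
  have h1 : |∫ s in (0 : ℝ)..v, (b - s) ^ (-σ)| ≤ (b - v) ^ (-σ) * |v - 0| := by
    rw [← Real.norm_eq_abs]
    refine intervalIntegral.norm_integral_le_of_norm_le_const fun s hs => ?_
    rw [Set.uIoc_of_le hv.le] at hs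
    rw [Real.norm_eq_abs, abs_of_nonneg (hk s hs).1]
    exact (hk s hs).2
  have h2 : |∫ s in (0 : ℝ)..v, (b - s) ^ (-σ) * φ' s| ≤
      ∫ s in (0 : ℝ)..v, (b - v) ^ (-σ) * (C * s ^ (σ - 1)) := by
    refine intervalIntegral.norm_integral_le_of_norm_le (μ := volume)
      (f := fun s => (b - s) ^ (-σ) * φ' s) hv.le
      (Filter.Eventually.of_forall fun s hs => ?_)
      (((intervalIntegral.intervalIntegrable_rpow' (r := σ - 1) (by linarith)).const_mul
        C).const_mul _)
    rw [norm_mul, Real.norm_eq_abs, Real.norm_eq_abs, abs_of_nonneg (hk s hs).1]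
    exact mul_le_mul (hk s hs).2 (hC s hs) (abs_nonneg _) hk0
  rw [intervalIntegral.integral_const_mul, intervalIntegral.integral_const_mul,
    integral_rpow_sub_one hσ0] at h2
  rw [localL1Error, ← integral_sub_rpow_neg hσ1]
  have h3 : |(∫ s in (0 : ℝ)..v, (b - s) ^ (-σ)) / (v - 0) * (φ v - φ 0)| ≤
      (b - v) ^ (-σ) * (C * (v ^ σ / σ)) := by
    rw [sub_zero, abs_of_pos hv] at h1
    rw [abs_mul, abs_div, sub_zero, abs_of_pos hv]
    exact mul_le_mul ((div_le_iff₀ hv).2 h1) hd (abs_nonneg _) hk0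
  refine (abs_sub _ _).trans ((add_le_add h3 h2).trans (le_of_eq ?_))
  ring

lemma abs_localL1Error_zero_self_le {σ C v : ℝ} {φ φ' : ℝ → ℝ} (hσ0 : 0 < σ) (hσ1 : σ < 1)
    (hv : 0 < v) (hC0 : 0 ≤ C)
    (hφc : ContinuousOn φ (Set.Icc 0 v)) (hφ : ∀ x ∈ Set.Ioc 0 v, HasDerivAt φ (φ' x) x)
    (hφ' : ContinuousOn φ' (Set.Ioc 0 v)) (hC : ∀ x ∈ Set.Ioc 0 v, |φ' x| ≤ C * x ^ (σ - 1)) :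
    |localL1Error σ v φ φ' 0 v| ≤ C / ((1 - σ) * σ) + C * (2 / σ + 2 / (1 - σ)) := by
  have hd := abs_sub_zero_le_of_abs_deriv_le hσ0 hv.le hφc hφ hφ' hC
  have h1σ : 0 < 1 - σ := by linarith
  have h2 : |∫ s in (0 : ℝ)..v, (v - s) ^ (-σ) * φ' s| ≤ _ :=
    intervalIntegral.norm_integral_le_of_norm_le (μ := volume) hv.le
      (Filter.Eventually.of_forall fun s hs => abs_kernel_mul_le hσ0 hσ1 hC0 hC hs)
      (intervalIntegrable_kernel_bound hσ0 hσ1 C v)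
  rw [intervalIntegral.integral_const_mul, intervalIntegral.integral_add
      ((intervalIntegral.intervalIntegrable_rpow' (by linarith)).const_mul _)
      ((intervalIntegrable_sub_rpow_neg hσ1 v 0 v).const_mul _),
    intervalIntegral.integral_const_mul, intervalIntegral.integral_const_mul,
    integral_rpow_sub_one hσ0, integral_sub_rpow_neg hσ1, sub_zero, sub_self,
    Real.zero_rpow h1σ.ne', sub_zero] at h2
  have two_le : ∀ p : ℝ, p ≤ 1 → (2 : ℝ) ^ p ≤ 2 := fun p hp => by
    simpa using Real.rpow_le_rpow_of_exponent_le (x := 2) (by norm_num) hp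
  have e1 : (v / 2) ^ (-σ) * (v ^ σ / σ) = 2 ^ σ / σ := by
    rw [Real.div_rpow hv.le (by norm_num), Real.rpow_neg hv.le, Real.rpow_neg (by norm_num)]
    have := (Real.rpow_pos_of_pos hv σ).ne'
    field_simp
  have e2 : (v / 2) ^ (σ - 1) * (v ^ (1 - σ) / (1 - σ)) = 2 ^ (1 - σ) / (1 - σ) := by
    rw [← neg_sub 1 σ, Real.div_rpow hv.le (by norm_num), Real.rpow_neg hv.le,
      Real.rpow_neg (by norm_num)]
    have := (Real.rpow_pos_of_pos hv (1 - σ)).ne'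
    field_simp
  rw [e1, e2] at h2
  have h3 : C * (2 ^ σ / σ + 2 ^ (1 - σ) / (1 - σ)) ≤ C * (2 / σ + 2 / (1 - σ)) := by
    gcongr <;> exact two_le _ (by linarith)
  have h4 : |(v ^ (1 - σ)) / (1 - σ) / v * (φ v - φ 0)| ≤ C / ((1 - σ) * σ) := by
    rw [abs_mul, abs_of_nonneg (by positivity)]
    refine (mul_le_mul_of_nonneg_left hd (by positivity)).trans (le_of_eq ?_)
    have : v ^ (1 - σ) * v ^ σ = v := by
      rw [← Real.rpow_add hv, sub_add_cancel, Real.rpow_one]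
    field_simp
    linear_combination C * this
  rw [localL1Error, sub_self, Real.zero_rpow h1σ.ne', sub_zero, sub_zero]
  exact (abs_sub _ _).trans (add_le_add h4 (h2.trans h3))

lemma rpow_sub_rpow_sub_one_le {γ k : ℝ} (hγ : 1 ≤ γ) (hk : 1 ≤ k) :
    k ^ γ - (k - 1) ^ γ ≤ γ * k ^ (γ - 1) := by
  have hk0 : 0 < k := by linarith
  have h := one_add_mul_self_le_rpow_one_add (s := -(1 / k))
    (by rw [neg_le_neg_iff, div_le_one hk0]; exact hk) hγ
  have e : 1 + -(1 / k) = (k - 1) / k := by field_simp; ring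
  have hp := Real.rpow_pos_of_pos hk0 γ
  rw [e, Real.div_rpow (by linarith) hk0.le, le_div_iff₀ hp] at h
  rw [Real.rpow_sub_one hk0.ne']
  have e2 : (1 + γ * -(1 / k)) * k ^ γ = k ^ γ - γ * (k ^ γ / k) := by ring
  linarith

lemma rpow_sub_one_le_rpow_sub_rpow {γ k : ℝ} (hγ : 1 ≤ γ) (hk : 1 ≤ k) :
    k ^ (γ - 1) ≤ k ^ γ - (k - 1) ^ γ := by
  have hk0 : 0 < k := by linarith
  have h1 : (k - 1) ^ γ ≤ (k - 1) * k ^ (γ - 1) := by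
    have : (k - 1) ^ γ = (k - 1) ^ (γ - 1) * (k - 1) := by
      rw [← Real.rpow_add_one' (by linarith) (by linarith), sub_add_cancel]
    rw [this, mul_comm]
    exact mul_le_mul_of_nonneg_left
      (Real.rpow_le_rpow (by linarith) (by linarith) (by linarith)) (by linarith)
  have h2 : k ^ γ = k * k ^ (γ - 1) := by
    rw [mul_comm, ← Real.rpow_add_one hk0.ne', sub_add_cancel]
  linarith

lemma half_rpow_le_rpow_sub {γ x y : ℝ} (hγ : 1 ≤ γ) (hx : 0 ≤ x) (hxy : 2 * x ≤ y) :
    y ^ γ / 2 ≤ y ^ γ - x ^ γ := by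
  have h1 : x ^ γ ≤ (y / 2) ^ γ := Real.rpow_le_rpow hx (by linarith) (by linarith)
  have h2 : (2 : ℝ) ≤ 2 ^ γ := by
    simpa using Real.rpow_le_rpow_of_exponent_le (x := 2) (by norm_num) hγ
  have hy : 0 ≤ y ^ γ := Real.rpow_nonneg (by linarith) _
  rw [Real.div_rpow (by linarith) (by norm_num)] at h1
  have h3 : y ^ γ / 2 ^ γ ≤ y ^ γ / 2 := by gcongr
  linarith

lemma sub_one_rpow_le {p k : ℝ} (hp : p ≤ 0) (hk : 2 ≤ k) :
    (k - 1) ^ p ≤ 2 ^ (-p) * k ^ p := by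
  have h : (k - 1) ^ p ≤ (k / 2) ^ p :=
    Real.rpow_le_rpow_of_nonpos (by linarith) (by linarith) hp
  rw [Real.div_rpow (by linarith) (by norm_num)] at h
  rw [Real.rpow_neg (by norm_num), mul_comm, ← div_eq_mul_inv]
  exact h

lemma rpow_neg_sub_rpow_neg_le {σ x y : ℝ} (hσ1 : σ ≤ 1) (hx : 0 < x) (hxy : x ≤ y) :
    x ^ (-σ) - y ^ (-σ) ≤ x ^ (-σ - 1) * (y - x) := by
  have hy : 0 < y := hx.trans_le hxy
  have hr1 : x / y ≤ 1 := (div_le_one hy).2 hxy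
  have h1 : x / y ≤ (x / y) ^ σ := by
    simpa using Real.rpow_le_rpow_of_exponent_ge (div_pos hx hy) hr1 hσ1
  have h2 : y ^ (-σ) = x ^ (-σ) * (x / y) ^ σ := by
    rw [Real.div_rpow hx.le hy.le, Real.rpow_neg hx.le, Real.rpow_neg hy.le]
    have := (Real.rpow_pos_of_pos hx σ).ne'
    field_simp
  have hp : 0 ≤ x ^ (-σ) := Real.rpow_nonneg hx.le _
  rw [Real.rpow_sub_one hx.ne', h2]
  have h3 : 1 - x / y ≤ (y - x) / x := by
    rw [one_sub_div hy.ne']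
    exact div_le_div_of_nonneg_left (by linarith) hx hxy
  calc x ^ (-σ) - x ^ (-σ) * (x / y) ^ σ = x ^ (-σ) * (1 - (x / y) ^ σ) := by ring
    _ ≤ x ^ (-σ) * ((y - x) / x) := mul_le_mul_of_nonneg_left (by linarith) hp
    _ = _ := by ring

lemma graded_left_endpoint_rpow_le {σ γ k : ℝ} (hσ1 : σ < 1) (hγ : 1 ≤ γ) (hk : 2 ≤ k) :
    ((k - 1) ^ γ) ^ (σ - 2) ≤ 2 ^ (γ * (2 - σ)) * k ^ (γ * (σ - 2)) := by
  rw [← Real.rpow_mul (by linarith)]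
  have h := sub_one_rpow_le (p := γ * (σ - 2))
    (mul_nonpos_of_nonneg_of_nonpos (by linarith) (by linarith)) hk
  rwa [show -(γ * (σ - 2)) = γ * (2 - σ) by ring] at h

lemma graded_last_cell_le {σ γ c n : ℝ} (hσ1 : σ < 1) (hγ : 1 ≤ γ) (hc : 0 < c) (hn : 2 ≤ n) :
    (c * (n - 1) ^ γ) ^ (σ - 2) * (c * n ^ γ - c * (n - 1) ^ γ) ^ (2 - σ) ≤
      2 ^ (γ * (2 - σ)) * γ ^ (2 - σ) * n ^ (σ - 2) := by
  have hn0 : 0 < n := by linarith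
  have hτ := rpow_sub_rpow_sub_one_le hγ (show 1 ≤ n by linarith)
  have hτ0 : 0 ≤ n ^ γ - (n - 1) ^ γ :=
    (Real.rpow_nonneg hn0.le _).trans (rpow_sub_one_le_rpow_sub_rpow hγ (by linarith))
  have h1 : (n ^ γ - (n - 1) ^ γ) ^ (2 - σ) ≤ γ ^ (2 - σ) * n ^ ((γ - 1) * (2 - σ)) := by
    rw [Real.rpow_mul hn0.le, ← Real.mul_rpow (by linarith) (Real.rpow_nonneg hn0.le _)]
    exact Real.rpow_le_rpow hτ0 hτ (by linarith)
  rw [← mul_sub, Real.mul_rpow hc.le (Real.rpow_nonneg (by linarith) _), Real.mul_rpow hc.le hτ0]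
  have ec : c ^ (σ - 2) * c ^ (2 - σ) = 1 := by
    rw [← Real.rpow_add hc]; simp
  have en : n ^ (γ * (σ - 2)) * n ^ ((γ - 1) * (2 - σ)) = n ^ (σ - 2) := by
    rw [← Real.rpow_add hn0]; ring_nf
  calc c ^ (σ - 2) * ((n - 1) ^ γ) ^ (σ - 2) * (c ^ (2 - σ) * (n ^ γ - (n - 1) ^ γ) ^ (2 - σ))
      = ((n - 1) ^ γ) ^ (σ - 2) * (n ^ γ - (n - 1) ^ γ) ^ (2 - σ) := by
        linear_combination (((n - 1) ^ γ) ^ (σ - 2) * (n ^ γ - (n - 1) ^ γ) ^ (2 - σ)) * ec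
    _ ≤ (2 ^ (γ * (2 - σ)) * n ^ (γ * (σ - 2))) * (γ ^ (2 - σ) * n ^ ((γ - 1) * (2 - σ))) :=
        mul_le_mul (graded_left_endpoint_rpow_le hσ1 hγ hn) h1 (Real.rpow_nonneg hτ0 _)
          (by positivity)
    _ = _ := by rw [← en]; ring

lemma graded_first_cell_le {σ γ c n : ℝ} (hσ0 : 0 < σ) (hγ : 1 ≤ γ) (hc : 0 < c) (hn : 2 ≤ n) :
    c ^ σ * (c * n ^ γ - c) ^ (-σ) ≤ 2 ^ σ * n ^ (-(γ * σ)) := by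
  have hn0 : 0 < n := by linarith
  have hnγ : 0 < n ^ γ := Real.rpow_pos_of_pos hn0 _
  have h := half_rpow_le_rpow_sub hγ zero_le_one (show 2 * 1 ≤ n by linarith)
  rw [Real.one_rpow] at h
  have h1 : (n ^ γ - 1) ^ (-σ) ≤ (n ^ γ / 2) ^ (-σ) :=
    Real.rpow_le_rpow_of_nonpos (by positivity) h (by linarith)
  have e : (n ^ γ / 2) ^ (-σ) = 2 ^ σ * n ^ (-(γ * σ)) := by
    rw [Real.div_rpow hnγ.le (by norm_num), ← Real.rpow_mul hn0.le, Real.rpow_neg (by norm_num)]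
    rw [div_inv_eq_mul, mul_neg, mul_comm]
  have ec : c ^ σ * c ^ (-σ) = 1 := by rw [← Real.rpow_add hc]; simp
  rw [show c * n ^ γ - c = c * (n ^ γ - 1) by ring, Real.mul_rpow hc.le (by linarith),
    ← mul_assoc, ec, one_mul]
  exact h1.trans_eq e

lemma graded_cell_scaling_le {σ γ c k n : ℝ} (hσ0 : 0 < σ) (hσ1 : σ < 1) (hγ : 1 ≤ γ)
    (hc : 0 < c) (hk : 2 ≤ k) (hkn : k + 1 ≤ n) :
    (c * (k - 1) ^ γ) ^ (σ - 2) * (c * k ^ γ - c * (k - 1) ^ γ) ^ 2 *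
        ((c * n ^ γ - c * k ^ γ) ^ (-σ) - (c * n ^ γ - c * (k - 1) ^ γ) ^ (-σ)) ≤
      2 ^ (γ * (2 - σ)) * γ ^ 2 * (k ^ (γ * σ - 2) *
        ((n ^ γ - k ^ γ) ^ (-σ) - (n ^ γ - (k - 1) ^ γ) ^ (-σ))) := by
  have hk0 : 0 < k := by linarith
  have hτ := rpow_sub_rpow_sub_one_le hγ (show 1 ≤ k by linarith)
  have hτ0 : 0 ≤ k ^ γ - (k - 1) ^ γ :=
    (Real.rpow_nonneg hk0.le _).trans (rpow_sub_one_le_rpow_sub_rpow hγ (by linarith))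
  have hnk : 0 < n ^ γ - k ^ γ :=
    sub_pos.2 (Real.rpow_lt_rpow hk0.le (by linarith) (by linarith))
  have hd : 0 ≤ (n ^ γ - k ^ γ) ^ (-σ) - (n ^ γ - (k - 1) ^ γ) ^ (-σ) :=
    sub_nonneg.2 (Real.rpow_le_rpow_of_nonpos hnk (by linarith) (by linarith))
  have h1 : (k ^ γ - (k - 1) ^ γ) ^ 2 ≤ γ ^ 2 * k ^ ((γ - 1) * 2) := by
    rw [Real.rpow_mul hk0.le, Real.rpow_two, ← mul_pow]
    exact pow_le_pow_left₀ hτ0 hτ 2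
  simp only [← mul_sub]
  rw [Real.mul_rpow hc.le (Real.rpow_nonneg (by linarith) _), Real.mul_rpow hc.le hnk.le,
    Real.mul_rpow hc.le (by linarith)]
  have ec : c ^ (σ - 2) * c ^ 2 * c ^ (-σ) = 1 := by
    rw [← Real.rpow_two, ← Real.rpow_add hc, ← Real.rpow_add hc]; ring_nf; simp
  have ek : k ^ (γ * (σ - 2)) * k ^ ((γ - 1) * 2) = k ^ (γ * σ - 2) := by
    rw [← Real.rpow_add hk0]; ring_nf
  set d := (n ^ γ - k ^ γ) ^ (-σ) - (n ^ γ - (k - 1) ^ γ) ^ (-σ) with hd_def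
  have hprod : ((k - 1) ^ γ) ^ (σ - 2) * (k ^ γ - (k - 1) ^ γ) ^ 2 ≤
      (2 ^ (γ * (2 - σ)) * k ^ (γ * (σ - 2))) * (γ ^ 2 * k ^ ((γ - 1) * 2)) :=
    mul_le_mul (graded_left_endpoint_rpow_le hσ1 hγ hk) h1 (sq_nonneg _) (by positivity)
  calc _ = ((k - 1) ^ γ) ^ (σ - 2) * (k ^ γ - (k - 1) ^ γ) ^ 2 * d := by
        rw [hd_def]
        linear_combination (((k - 1) ^ γ) ^ (σ - 2) * (k ^ γ - (k - 1) ^ γ) ^ 2 * d) * ec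
    _ ≤ _ := mul_le_mul_of_nonneg_right hprod hd
    _ = _ := by rw [← ek]; ring

lemma graded_weight_mul_diff_le {σ γ k n : ℝ} (hσ0 : 0 < σ) (hσ1 : σ < 1) (hγ : 1 ≤ γ)
    (hk : 2 ≤ k) (hkn : k + 1 ≤ n) :
    k ^ (γ * σ - 2) * ((n ^ γ - k ^ γ) ^ (-σ) - (n ^ γ - (k - 1) ^ γ) ^ (-σ)) ≤
      2 ^ (σ + 1) * γ * (n ^ (-min (2 - σ) (γ * σ)) * k ^ (-1 - σ)) +
        4 * n ^ (γ * σ - 2) * ((n ^ γ - k ^ γ) ^ (-σ) - (n ^ γ - (k - 1) ^ γ) ^ (-σ)) := by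
  have hk0 : 0 < k := by linarith
  have hn0 : 0 < n := by linarith
  have hτ := rpow_sub_rpow_sub_one_le hγ (show 1 ≤ k by linarith)
  have hτ0 : 0 ≤ k ^ γ - (k - 1) ^ γ :=
    (Real.rpow_nonneg hk0.le _).trans (rpow_sub_one_le_rpow_sub_rpow hγ (by linarith))
  have hnk : 0 < n ^ γ - k ^ γ :=
    sub_pos.2 (Real.rpow_lt_rpow hk0.le (by linarith) (by linarith))
  have hd : 0 ≤ (n ^ γ - k ^ γ) ^ (-σ) - (n ^ γ - (k - 1) ^ γ) ^ (-σ) :=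
    sub_nonneg.2 (Real.rpow_le_rpow_of_nonpos hnk (by linarith) (by linarith))
  rcases le_total (2 * k) n with h | h
  · have hhalf := half_rpow_le_rpow_sub hγ hk0.le h
    have hnγ : 0 < n ^ γ := Real.rpow_pos_of_pos hn0 _
    have h1 := rpow_neg_sub_rpow_neg_le hσ1.le hnk
      (show n ^ γ - k ^ γ ≤ n ^ γ - (k - 1) ^ γ by linarith)
    have h2 : (n ^ γ - k ^ γ) ^ (-σ - 1) ≤ 2 ^ (σ + 1) * n ^ (-(γ * σ + γ)) := by
      refine (Real.rpow_le_rpow_of_nonpos (by positivity) hhalf (by linarith)).trans_eq ?_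
      rw [Real.div_rpow hnγ.le (by norm_num), ← Real.rpow_mul hn0.le,
        show -σ - 1 = -(σ + 1) by ring, Real.rpow_neg (x := 2) (by norm_num), div_inv_eq_mul,
        mul_comm]
      ring_nf
    have h3 : (n ^ γ - k ^ γ) ^ (-σ) - (n ^ γ - (k - 1) ^ γ) ^ (-σ) ≤
        (2 ^ (σ + 1) * n ^ (-(γ * σ + γ))) * (γ * k ^ (γ - 1)) :=
      h1.trans (mul_le_mul h2 (by linarith) (by linarith) (by positivity))
    set m := min (2 - σ) (γ * σ) with hm
    have hm1 : m ≤ 2 - σ := min_le_left _ _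
    have hm2 : m ≤ γ * σ := min_le_right _ _
    have h4 : k ^ (γ * σ - 2) * k ^ (γ - 1) ≤ n ^ (γ * σ + γ - m) * k ^ (-1 - σ) := by
      have e : k ^ (γ * σ - 2) * k ^ (γ - 1) = k ^ (γ * σ + γ - m) * k ^ (m - 3) := by
        rw [← Real.rpow_add hk0, ← Real.rpow_add hk0]; ring_nf
      rw [e]
      exact mul_le_mul (Real.rpow_le_rpow hk0.le (by linarith) (by linarith))
        (Real.rpow_le_rpow_of_exponent_le (by linarith) (by linarith)) (by positivity)
        (by positivity)
    have en : n ^ (-(γ * σ + γ)) * n ^ (γ * σ + γ - m) = n ^ (-m) := by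
      rw [← Real.rpow_add hn0]; ring_nf
    have hγ0 : 0 ≤ γ := by linarith
    calc _ ≤ k ^ (γ * σ - 2) * ((2 ^ (σ + 1) * n ^ (-(γ * σ + γ))) * (γ * k ^ (γ - 1))) :=
          mul_le_mul_of_nonneg_left h3 (by positivity)
      _ = (2 ^ (σ + 1) * γ * n ^ (-(γ * σ + γ))) * (k ^ (γ * σ - 2) * k ^ (γ - 1)) := by ring
      _ ≤ (2 ^ (σ + 1) * γ * n ^ (-(γ * σ + γ))) * (n ^ (γ * σ + γ - m) * k ^ (-1 - σ)) :=
          mul_le_mul_of_nonneg_left h4 (by positivity)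
      _ = 2 ^ (σ + 1) * γ * (n ^ (-m) * k ^ (-1 - σ)) := by rw [← en]; ring
      _ ≤ _ := le_add_of_nonneg_right (mul_nonneg (by positivity) hd)
  · have h1 : k ^ (γ * σ - 2) ≤ 4 * n ^ (γ * σ - 2) := by
      rw [Real.rpow_sub hk0, Real.rpow_sub hn0, Real.rpow_two, Real.rpow_two]
      have h2 : k ^ (γ * σ) ≤ n ^ (γ * σ) :=
        Real.rpow_le_rpow hk0.le (by linarith) (by positivity)
      have h3 : n ^ 2 ≤ 4 * k ^ 2 := by nlinarith
      rw [div_le_iff₀ (by positivity)]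
      calc k ^ (γ * σ) ≤ n ^ (γ * σ) := h2
        _ = n ^ (γ * σ) / n ^ 2 * n ^ 2 := by field_simp
        _ ≤ n ^ (γ * σ) / n ^ 2 * (4 * k ^ 2) := mul_le_mul_of_nonneg_left h3 (by positivity)
        _ = _ := by ring
    have hγ0 : 0 ≤ γ := by linarith
    exact (mul_le_mul_of_nonneg_right h1 hd).trans (le_add_of_nonneg_left (by positivity))

lemma graded_penultimate_rpow_le {σ γ n : ℝ} (hσ0 : 0 < σ) (hγ : 1 ≤ γ) (hn : 1 ≤ n) :
    n ^ (γ * σ - 2) * (n ^ γ - (n - 1) ^ γ) ^ (-σ) ≤ n ^ (σ - 2) := by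
  have hn0 : 0 < n := by linarith
  have h := Real.rpow_le_rpow_of_nonpos (Real.rpow_pos_of_pos hn0 _)
    (rpow_sub_one_le_rpow_sub_rpow hγ hn) (show -σ ≤ 0 by linarith)
  refine (mul_le_mul_of_nonneg_left h (by positivity)).trans_eq ?_
  rw [← Real.rpow_mul hn0.le, ← Real.rpow_add hn0]
  ring_nf

/-- A bound, uniform in the mesh, for the sum of the local errors times `n ^ min (2 - σ) (γ * σ)`. -/
noncomputable def gradedL1Const (σ γ C : ℝ) : ℝ :=
  (C / ((1 - σ) * σ) + C * (2 / σ + 2 / (1 - σ))) + 2 * (C / σ) * 2 ^ σ +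
    C / (1 - σ) * (2 ^ (γ * (2 - σ)) * γ ^ (2 - σ)) +
    C * (2 ^ (γ * (2 - σ)) * γ ^ 2) *
      (2 ^ (σ + 1) * γ * (∑' k : ℕ, (k : ℝ) ^ (-1 - σ)) + 4)

section GradedMesh

variable {σ γ C c : ℝ} {n : ℕ} {φ φ' φ'' : ℝ → ℝ}

lemma abs_localL1Error_graded_interior_le (hσ0 : 0 < σ) (hσ1 : σ < 1) (hγ : 1 ≤ γ) (hc : 0 < c)
    (hC : 0 < C) (hφ : ∀ x ∈ Set.Ioc 0 (c * (n : ℝ) ^ γ), HasDerivAt φ (φ' x) x)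
    (hφ' : ∀ x ∈ Set.Ioc 0 (c * (n : ℝ) ^ γ), HasDerivAt φ' (φ'' x) x)
    (hφ'' : ∀ x ∈ Set.Ioc 0 (c * (n : ℝ) ^ γ), |φ'' x| ≤ C * x ^ (σ - 2))
    {k : ℝ} (hk : 2 ≤ k) (hkn : k + 1 ≤ n) :
    |localL1Error σ (c * (n : ℝ) ^ γ) φ φ' (c * (k - 1) ^ γ) (c * k ^ γ)| ≤
      C * (2 ^ (γ * (2 - σ)) * γ ^ 2) *
        (2 ^ (σ + 1) * γ * ((n : ℝ) ^ (-min (2 - σ) (γ * σ)) * k ^ (-1 - σ)) +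
          4 * (n : ℝ) ^ (γ * σ - 2) * (((n : ℝ) ^ γ - k ^ γ) ^ (-σ) -
            ((n : ℝ) ^ γ - (k - 1) ^ γ) ^ (-σ))) := by
  have hu : 0 < c * (k - 1) ^ γ := mul_pos hc (Real.rpow_pos_of_pos (by linarith) _)
  have huv : c * (k - 1) ^ γ < c * k ^ γ :=
    mul_lt_mul_of_pos_left (Real.rpow_lt_rpow (by linarith) (by linarith) (by linarith)) hc
  have hvb : c * k ^ γ < c * (n : ℝ) ^ γ :=
    mul_lt_mul_of_pos_left (Real.rpow_lt_rpow (by linarith) (by linarith) (by linarith)) hc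
  have hsub : Set.Icc (c * (k - 1) ^ γ) (c * k ^ γ) ⊆ Set.Ioc 0 (c * (n : ℝ) ^ γ) :=
    fun x hx => ⟨hu.trans_le hx.1, hx.2.trans hvb.le⟩
  have h := abs_localL1Error_le_of_lt hσ0 hσ1 huv hvb (fun x hx => hφ x (hsub hx))
    (fun x hx => hφ' x (hsub hx)) (M := C * (c * (k - 1) ^ γ) ^ (σ - 2)) fun x hx =>
      (hφ'' x (hsub hx)).trans (mul_le_mul_of_nonneg_left
        (Real.rpow_le_rpow_of_nonpos hu hx.1 (by linarith)) hC.le)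
  have h1 := mul_le_mul_of_nonneg_left (graded_cell_scaling_le hσ0 hσ1 hγ hc hk hkn) hC.le
  have h2 := mul_le_mul_of_nonneg_left (graded_weight_mul_diff_le hσ0 hσ1 hγ hk hkn)
    (show 0 ≤ C * (2 ^ (γ * (2 - σ)) * γ ^ 2) by positivity)
  linarith

lemma abs_localL1Error_graded_last_le (hσ1 : σ < 1) (hγ : 1 ≤ γ) (hc : 0 < c)
    (hC : 0 < C) (hφ : ∀ x ∈ Set.Ioc 0 (c * (n : ℝ) ^ γ), HasDerivAt φ (φ' x) x)
    (hφ' : ∀ x ∈ Set.Ioc 0 (c * (n : ℝ) ^ γ), HasDerivAt φ' (φ'' x) x)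
    (hφ'' : ∀ x ∈ Set.Ioc 0 (c * (n : ℝ) ^ γ), |φ'' x| ≤ C * x ^ (σ - 2))
    (hn : (2 : ℝ) ≤ n) :
    |localL1Error σ (c * (n : ℝ) ^ γ) φ φ' (c * ((n : ℝ) - 1) ^ γ) (c * (n : ℝ) ^ γ)| ≤
      C / (1 - σ) * (2 ^ (γ * (2 - σ)) * γ ^ (2 - σ)) * (n : ℝ) ^ (σ - 2) := by
  have hu : 0 < c * ((n : ℝ) - 1) ^ γ := mul_pos hc (Real.rpow_pos_of_pos (by linarith) _)
  have huv : c * ((n : ℝ) - 1) ^ γ < c * (n : ℝ) ^ γ :=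
    mul_lt_mul_of_pos_left (Real.rpow_lt_rpow (by linarith) (by linarith) (by linarith)) hc
  have hsub : Set.Icc (c * ((n : ℝ) - 1) ^ γ) (c * (n : ℝ) ^ γ) ⊆ Set.Ioc 0 (c * (n : ℝ) ^ γ) :=
    fun x hx => ⟨hu.trans_le hx.1, hx.2⟩
  have h := abs_localL1Error_right_le hσ1 huv (fun x hx => hφ x (hsub hx))
    (fun x hx => hφ' x (hsub hx)) (M := C * (c * ((n : ℝ) - 1) ^ γ) ^ (σ - 2)) fun x hx =>
      (hφ'' x (hsub hx)).trans (mul_le_mul_of_nonneg_left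
        (Real.rpow_le_rpow_of_nonpos hu hx.1 (by linarith)) hC.le)
  have h1 := mul_le_mul_of_nonneg_left (graded_last_cell_le hσ1 hγ hc hn)
    (div_nonneg hC.le (by linarith : 0 ≤ 1 - σ))
  calc _ ≤ _ := h
    _ = _ := by ring
    _ ≤ _ := h1
    _ = _ := by ring

lemma sum_abs_localL1Error_graded_le (hσ0 : 0 < σ) (hσ1 : σ < 1) (hγ : 1 ≤ γ) (hc : 0 < c)
    (hC : 0 < C) (hφc : ContinuousOn φ (Set.Icc 0 (c * (n : ℝ) ^ γ)))
    (hφ : ∀ x ∈ Set.Ioc 0 (c * (n : ℝ) ^ γ), HasDerivAt φ (φ' x) x)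
    (hφ' : ∀ x ∈ Set.Ioc 0 (c * (n : ℝ) ^ γ), HasDerivAt φ' (φ'' x) x)
    (hφ'b : ∀ x ∈ Set.Ioc 0 (c * (n : ℝ) ^ γ), |φ' x| ≤ C * x ^ (σ - 1))
    (hφ'' : ∀ x ∈ Set.Ioc 0 (c * (n : ℝ) ^ γ), |φ'' x| ≤ C * x ^ (σ - 2)) (hn : 1 ≤ n) :
    ∑ i ∈ Finset.range n, |localL1Error σ (c * (n : ℝ) ^ γ) φ φ' (c * (i : ℝ) ^ γ)
        (c * ((i + 1 : ℕ) : ℝ) ^ γ)| ≤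
      gradedL1Const σ γ C * (n : ℝ) ^ (-min (2 - σ) (γ * σ)) := by
  have h1σ : 0 < 1 - σ := by linarith
  have hZ : Summable fun k : ℕ => (k : ℝ) ^ (-1 - σ) := Real.summable_nat_rpow.2 (by linarith)
  have hZ0 : 0 ≤ ∑' k : ℕ, (k : ℝ) ^ (-1 - σ) :=
    tsum_nonneg fun k => Real.rpow_nonneg (Nat.cast_nonneg k) _
  have hz : (0 : ℝ) ^ γ = 0 := Real.zero_rpow (by linarith)
  have hcont : ContinuousOn φ' (Set.Ioc 0 (c * (n : ℝ) ^ γ)) :=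
    fun x hx => (hφ' x hx).continuousAt.continuousWithinAt
  have p1 : 0 ≤ C / ((1 - σ) * σ) + C * (2 / σ + 2 / (1 - σ)) := by positivity
  have p2 : 0 ≤ 2 * (C / σ) * 2 ^ σ := by positivity
  have p3 : 0 ≤ C / (1 - σ) * (2 ^ (γ * (2 - σ)) * γ ^ (2 - σ)) := by positivity
  have p4 : 0 ≤ C * (2 ^ (γ * (2 - σ)) * γ ^ 2) := by positivity
  have p5 : 0 ≤ 2 ^ (σ + 1) * γ := by positivity
  have p6 := mul_nonneg p4 (add_nonneg (mul_nonneg p5 hZ0) (show (0 : ℝ) ≤ 4 by norm_num))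
  obtain rfl | ⟨m, rfl⟩ : n = 1 ∨ ∃ m, n = m + 2 := by
    rcases n with _ | _ | m
    · omega
    · exact Or.inl rfl
    · exact Or.inr ⟨m, rfl⟩
  · simp only [Nat.cast_one, Real.one_rpow, mul_one] at *
    simp only [Finset.range_one, Finset.sum_singleton, Nat.cast_zero, zero_add, hz, mul_zero,
      Nat.cast_one, Real.one_rpow, mul_one]
    have h := abs_localL1Error_zero_self_le hσ0 hσ1 hc hC.le hφc hφ hcont hφ'b
    unfold gradedL1Const
    linarith
  set μ := min (2 - σ) (γ * σ) with hμ
  have hn2 : (2 : ℝ) ≤ ((m + 2 : ℕ) : ℝ) := by push_cast; linarith [Nat.cast_nonneg (α := ℝ) m]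
  set x : ℝ := ((m + 2 : ℕ) : ℝ) with hx
  have hx1 : 1 ≤ x := by linarith
  have hσμ : x ^ (σ - 2) ≤ x ^ (-μ) :=
    Real.rpow_le_rpow_of_exponent_le hx1 (by linarith [min_le_left (2 - σ) (γ * σ)])
  have hγμ : x ^ (-(γ * σ)) ≤ x ^ (-μ) :=
    Real.rpow_le_rpow_of_exponent_le hx1 (by linarith [min_le_right (2 - σ) (γ * σ)])
  have hxμ : 0 ≤ x ^ (-μ) := Real.rpow_nonneg (by linarith) _
  have hlast := abs_localL1Error_graded_last_le hσ1 hγ hc hC hφ hφ' hφ'' hn2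
  have hfirst : |localL1Error σ (c * x ^ γ) φ φ' 0 c| ≤ 2 * (C / σ) * (2 ^ σ * x ^ (-(γ * σ))) := by
    have hcx : c < c * x ^ γ := by
      have : 1 < x ^ γ := Real.one_lt_rpow (by linarith) (by linarith)
      nlinarith
    have hsub : Set.Ioc 0 c ⊆ Set.Ioc 0 (c * x ^ γ) := Set.Ioc_subset_Ioc_right hcx.le
    refine (abs_localL1Error_zero_le_of_lt hσ0 hσ1 hc hcx
      (hφc.mono (Set.Icc_subset_Icc_right hcx.le)) (fun y hy => hφ y (hsub hy))
      (hcont.mono hsub) (fun y hy => hφ'b y (hsub hy))).trans ?_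
    exact mul_le_mul_of_nonneg_left (graded_first_cell_le hσ0 hγ hc hn2) (by positivity)
  have hmid : ∑ i ∈ Finset.range m, |localL1Error σ (c * x ^ γ) φ φ' (c * ((i + 1 : ℕ) : ℝ) ^ γ)
      (c * ((i + 1 + 1 : ℕ) : ℝ) ^ γ)| ≤
      C * (2 ^ (γ * (2 - σ)) * γ ^ 2) *
        (2 ^ (σ + 1) * γ * (∑' k : ℕ, (k : ℝ) ^ (-1 - σ)) + 4) * x ^ (-μ) := by
    let F : ℕ → ℝ := fun j => (x ^ γ - ((j + 1 : ℕ) : ℝ) ^ γ) ^ (-σ)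
    have hterm : ∀ i ∈ Finset.range m,
        |localL1Error σ (c * x ^ γ) φ φ' (c * ((i + 1 : ℕ) : ℝ) ^ γ)
          (c * ((i + 1 + 1 : ℕ) : ℝ) ^ γ)| ≤
        C * (2 ^ (γ * (2 - σ)) * γ ^ 2) *
          (2 ^ (σ + 1) * γ * (x ^ (-μ) * ((i + 2 : ℕ) : ℝ) ^ (-1 - σ)) +
            4 * x ^ (γ * σ - 2) * (F (i + 1) - F i)) := by
      intro i hi
      have him : (i : ℝ) + 1 ≤ m := by exact_mod_cast Finset.mem_range.1 hi
      have h := abs_localL1Error_graded_interior_le hσ0 hσ1 hγ hc hC hφ hφ' hφ''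
        (k := ((i + 2 : ℕ) : ℝ)) (by push_cast; linarith [Nat.cast_nonneg (α := ℝ) i])
        (by push_cast; linarith)
      have e : ((i + 2 : ℕ) : ℝ) - 1 = ((i + 1 : ℕ) : ℝ) := by push_cast; ring
      rw [e] at h
      exact h
    refine (Finset.sum_le_sum hterm).trans ?_
    rw [← Finset.mul_sum, Finset.sum_add_distrib, ← Finset.mul_sum, ← Finset.mul_sum,
      ← Finset.mul_sum, Finset.sum_range_sub, mul_assoc _ _ (x ^ (-μ))]
    refine mul_le_mul_of_nonneg_left ?_ p4
    have hs : ∑ i ∈ Finset.range m, ((i + 2 : ℕ) : ℝ) ^ (-1 - σ) ≤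
        ∑' k : ℕ, (k : ℝ) ^ (-1 - σ) := by
      refine (Summable.sum_le_tsum (Finset.range m) (fun i _ => by positivity)
        ((summable_nat_add_iff 2).2 hZ)).trans ?_
      rw [← hZ.sum_add_tsum_nat_add 2]
      exact le_add_of_nonneg_left (Finset.sum_nonneg fun i _ => by positivity)
    have hF0 : 0 ≤ F 0 := by
      refine Real.rpow_nonneg (sub_nonneg.2 (Real.rpow_le_rpow (by positivity) ?_ (by linarith))) _
      simpa using hx1
    have hFm : F m = (x ^ γ - (x - 1) ^ γ) ^ (-σ) := by
      have e : x - 1 = ((m + 1 : ℕ) : ℝ) := by rw [hx]; push_cast; ring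
      rw [e]
    have hpen := graded_penultimate_rpow_le hσ0 hγ hx1
    rw [← hFm] at hpen
    have hxp : 0 ≤ x ^ (γ * σ - 2) := Real.rpow_nonneg (by linarith) _
    have a1 := mul_le_mul_of_nonneg_left (mul_le_mul_of_nonneg_left hs hxμ) p5
    have a2 := mul_nonneg hxp hF0
    linarith
  rw [Finset.sum_range_succ, Finset.sum_range_succ']
  have e0 : localL1Error σ (c * x ^ γ) φ φ' (c * ((0 : ℕ) : ℝ) ^ γ) (c * ((0 + 1 : ℕ) : ℝ) ^ γ) =
      localL1Error σ (c * x ^ γ) φ φ' 0 c := by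
    simp [hz]
  have e1 : x - 1 = ((m + 1 : ℕ) : ℝ) := by rw [hx]; push_cast; ring
  rw [e1] at hlast
  rw [e0]
  unfold gradedL1Const
  have b1 := mul_le_mul_of_nonneg_left hγμ p2
  have b2 := mul_le_mul_of_nonneg_left hσμ p3
  have b3 := mul_nonneg p1 hxμ
  refine (add_le_add (add_le_add hmid hfirst) hlast).trans ?_
  linarith

end GradedMesh

/-- nonuniform L1 truncation error on the graded mesh: Let
`φ : [0,T] → ℝ` be continuous on `[0,T]` and twice continuously differentiable
on `(0,T]`, with `|φ′(t)| ≤ C t^{σ−1}` and `|φ″(t)| ≤ C t^{σ−2}` for all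
`t ∈ (0,T]`. Then there exists `Q > 0` depending only on `C`, `σ`, `γ` and `T`
(but not on `n` or `N`) such that for every `1 ≤ n ≤ N`,
`| Σ_{k=1}^{n} a^{(n)}_{n−k} (φ(t_k) − φ(t_{k−1}))
   − (1/Γ(1−σ)) ∫_0^{t_n} (t_n − s)^{−σ} φ′(s) ds | ≤ Q n^{−min(2−σ, γσ)}`. -/
theorem L1_truncation_error_bound
    (σ T γ C : ℝ) (hσ0 : 0 < σ) (hσ1 : σ < 1) (hT : 0 < T) (hγ : 1 ≤ γ)
    (hC : 0 < C) :
    ∃ Q > 0, ∀ N : ℕ, 1 ≤ N → ∀ t : ℕ → ℝ,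
      (∀ n : ℕ, n ≤ N → t n = T * ((n : ℝ) / (N : ℝ)) ^ γ) →
      ∀ φ φ' φ'' : ℝ → ℝ,
        ContinuousOn φ (Set.Icc 0 T) →
        (∀ x ∈ Set.Ioc (0 : ℝ) T, HasDerivAt φ (φ' x) x) →
        (∀ x ∈ Set.Ioc (0 : ℝ) T, HasDerivAt φ' (φ'' x) x) →
        ContinuousOn φ'' (Set.Ioc 0 T) →
        (∀ x ∈ Set.Ioc (0 : ℝ) T, |φ' x| ≤ C * x ^ (σ - 1)) →
        (∀ x ∈ Set.Ioc (0 : ℝ) T, |φ'' x| ≤ C * x ^ (σ - 2)) →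
        ∀ n : ℕ, 1 ≤ n → n ≤ N →
          |(∑ k ∈ Finset.Icc 1 n,
              (((t n - t (k - 1)) ^ (1 - σ) / Real.Gamma (2 - σ)
                - (t n - t k) ^ (1 - σ) / Real.Gamma (2 - σ)) / (t k - t (k - 1))) *
                (φ (t k) - φ (t (k - 1))))
            - (1 / Real.Gamma (1 - σ)) *
                ∫ s in (0 : ℝ)..(t n), (t n - s) ^ (-σ) * φ' s|
          ≤ Q * (n : ℝ) ^ (-min (2 - σ) (γ * σ)) := by
  have h1σ : 0 < 1 - σ := by linarith
  have hΓ : 0 < Real.Gamma (1 - σ) := Real.Gamma_pos_of_pos h1σ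
  have hΓ2 : Real.Gamma (2 - σ) = (1 - σ) * Real.Gamma (1 - σ) := by
    rw [← Real.Gamma_add_one h1σ.ne']; ring_nf
  have hZ0 : 0 ≤ ∑' k : ℕ, (k : ℝ) ^ (-1 - σ) :=
    tsum_nonneg fun k => Real.rpow_nonneg (Nat.cast_nonneg k) _
  refine ⟨1 / Real.Gamma (1 - σ) * gradedL1Const σ γ C, ?_, ?_⟩
  · unfold gradedL1Const
    positivity
  intro N hN t ht φ φ' φ'' hφc hφ hφ' _ hφ'b hφ''b n hn hnN
  have hN0 : (0 : ℝ) < N := by exact_mod_cast hN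
  set c : ℝ := T / (N : ℝ) ^ γ with hc_def
  have hc : 0 < c := by positivity
  have htc : ∀ i : ℕ, i ≤ N → t i = c * (i : ℝ) ^ γ := fun i hi => by
    rw [ht i hi, Real.div_rpow (Nat.cast_nonneg i) hN0.le, hc_def]
    ring
  have htn := htc n hnN
  have ht0 : t 0 = 0 := by
    rw [htc 0 (Nat.zero_le _), Nat.cast_zero, Real.zero_rpow (by linarith), mul_zero]
  have hmono : ∀ i j : ℕ, i ≤ j → j ≤ N → t i ≤ t j := fun i j hij hj => by
    rw [htc i (hij.trans hj), htc j hj]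
    gcongr
  have htnT : c * (n : ℝ) ^ γ ≤ T := by
    have e : c * (N : ℝ) ^ γ = T := by rw [hc_def]; field_simp
    rw [← e]
    gcongr
  have hsub : Set.Ioc 0 (c * (n : ℝ) ^ γ) ⊆ Set.Ioc 0 T := Set.Ioc_subset_Ioc_right htnT
  have hsum := sum_abs_localL1Error_graded_le (n := n) hσ0 hσ1 hγ hc hC
    (hφc.mono (Set.Icc_subset_Icc_right htnT)) (fun x hx => hφ x (hsub hx))
    (fun x hx => hφ' x (hsub hx)) (fun x hx => hφ'b x (hsub hx))
    (fun x hx => hφ''b x (hsub hx)) hn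
  have hint : IntervalIntegrable (fun s => (t n - s) ^ (-σ) * φ' s) volume 0 (t n) := by
    rw [htn]
    exact intervalIntegrable_kernel_mul hσ0 hσ1 (by positivity) hC.le
      (fun x hx => (hφ' x (hsub hx)).continuousAt.continuousWithinAt)
      (fun x hx => hφ'b x (hsub hx))
  have hsplit : ∑ i ∈ Finset.range n, ∫ s in t i..t (i + 1), (t n - s) ^ (-σ) * φ' s =
      ∫ s in (0 : ℝ)..t n, (t n - s) ^ (-σ) * φ' s := by
    rw [intervalIntegral.sum_integral_adjacent_intervals, ht0]
    intro k hk
    refine hint.mono_set ?_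
    have h0 : 0 ≤ t k := ht0 ▸ hmono 0 k (Nat.zero_le _) (by omega)
    have h1 : t k ≤ t (k + 1) := hmono k (k + 1) (by omega) (by omega)
    have h2 : t (k + 1) ≤ t n := hmono (k + 1) n (by omega) hnN
    rw [Set.uIcc_of_le h1, Set.uIcc_of_le (h0.trans (h1.trans h2))]
    exact Set.Icc_subset_Icc h0 h2
  have hreindex : ∀ f : ℕ → ℝ, ∑ k ∈ Finset.Icc 1 n, f k = ∑ i ∈ Finset.range n, f (i + 1) :=
    fun f => by
      rw [Finset.range_eq_Ico, Finset.sum_Ico_add', zero_add]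
      rfl
  rw [hreindex, ← hsplit, Finset.mul_sum, ← Finset.sum_sub_distrib]
  have hcell : ∀ i ∈ Finset.range n,
      ((t n - t (i + 1 - 1)) ^ (1 - σ) / Real.Gamma (2 - σ) -
          (t n - t (i + 1)) ^ (1 - σ) / Real.Gamma (2 - σ)) / (t (i + 1) - t (i + 1 - 1)) *
          (φ (t (i + 1)) - φ (t (i + 1 - 1))) -
        1 / Real.Gamma (1 - σ) * ∫ s in t i..t (i + 1), (t n - s) ^ (-σ) * φ' s =
      1 / Real.Gamma (1 - σ) * localL1Error σ (c * (n : ℝ) ^ γ) φ φ' (c * (i : ℝ) ^ γ)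
        (c * ((i + 1 : ℕ) : ℝ) ^ γ) := by
    intro i hi
    have hi' := Finset.mem_range.1 hi
    rw [← htc i (by omega), ← htc (i + 1) (by omega), ← htn, Nat.add_sub_cancel, hΓ2, localL1Error,
      mul_sub]
    rw [← sub_div, mul_comm (1 - σ), ← div_div, div_right_comm _ (Real.Gamma _)]
    ring
  rw [Finset.sum_congr rfl hcell, ← Finset.mul_sum, abs_mul, abs_of_pos (by positivity), mul_assoc]
  exact mul_le_mul_of_nonneg_left ((Finset.abs_sum_le_sum_abs _ _).trans hsum) (by positivity)
end
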